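/- For every recursively enumerable set R ⊆ ℚ ∪ {∞}, there exists a tiling system τ such that Sl_τ = R. Consequently, the sets of slopes of tiling systems are exactly the recursively enumerable subsets of ℚ ∪ {∞}. -/

import Mathlib

/-- A finite pattern: a finite support in `ℤ²` together with tile data. -/
structure Pattern (T : Type) where
  support : Finset (ℤ × ℤ)
  data : ℤ × ℤ → T

/-- A tiling system: a finite set of finite forbidden patterns over the tile set `T`. -/
structure TilingSystem (T : Type) where
  F : Set (Pattern T)
  finite : F.Finite

/-- A tiling is valid when no translate of a forbidden pattern appears in it. -/
def TilingSystem.Valid {T : Type} (τ : TilingSystem T) (c : ℤ × ℤ → T) : Prop :=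
  ∀ p ∈ τ.F, ∀ u : ℤ × ℤ, ∃ n ∈ p.support, c (n + u) ≠ p.data n

/-- A vector `v` is a period of the tiling `c`. -/
def IsPeriod {T : Type} (c : ℤ × ℤ → T) (v : ℤ × ℤ) : Prop :=
  ∀ x : ℤ × ℤ, c (x + v) = c x

/-- The direction of a vector of `ℤ²`, an element of `ℚ ∪ {∞}` modelled as `Option ℚ`
(`none` being `∞`, obtained when the first coordinate vanishes). -/
def dir (v : ℤ × ℤ) : Option ℚ :=
  if v.1 = 0 then none else some ((v.2 : ℚ) / (v.1 : ℚ))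

/-- A tiling has slope `θ` when it has a nonzero period and all its nonzero
periods have direction `θ`. -/
def HasSlope {T : Type} (c : ℤ × ℤ → T) (θ : Option ℚ) : Prop :=
  (∃ v : ℤ × ℤ, v ≠ 0 ∧ IsPeriod c v ∧ dir v = θ) ∧
    ∀ v : ℤ × ℤ, v ≠ 0 → IsPeriod c v → dir v = θ

/-- The set of slopes of all valid tilings of a tiling system. -/
def TilingSystem.Slopes {T : Type} (τ : TilingSystem T) : Set (Option ℚ) :=
  {θ : Option ℚ | ∃ c : ℤ × ℤ → T, τ.Valid c ∧ HasSlope c θ}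


/-! ### Part 1: locally defined sets of configurations are tiling systems -/

/-- `S` is the set of slopes of some tiling system. -/
def IsSlopeSet (S : Set (Option ℚ)) : Prop :=
  ∃ (N : ℕ) (τ : TilingSystem (Fin N)), τ.Slopes = S

/-- A predicate on configurations depending only on the finite window `W`. -/
def LocalPred {T : Type} (W : Finset (ℤ × ℤ)) (P : (ℤ × ℤ → T) → Prop) : Prop :=
  ∀ a b : ℤ × ℤ → T, (∀ n ∈ W, a n = b n) → P a → P b

theorem isPeriod_comp_iff {T U : Type} (e : T → U) (he : Function.Injective e) (c : ℤ × ℤ → T)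
    (v : ℤ × ℤ) : IsPeriod (fun x => e (c x)) v ↔ IsPeriod c v := by
  simp [IsPeriod, he.eq_iff]

theorem hasSlope_comp_iff {T U : Type} (e : T → U) (he : Function.Injective e) (c : ℤ × ℤ → T)
    (θ : Option ℚ) : HasSlope (fun x => e (c x)) θ ↔ HasSlope c θ := by
  simp [HasSlope, isPeriod_comp_iff e he]

theorem isSlopeSet_of_local {T : Type} [Finite T] [Nonempty T] (W : Finset (ℤ × ℤ))
    (P : (ℤ × ℤ → T) → Prop) (hP : LocalPred W P) :
    IsSlopeSet {θ | ∃ c : ℤ × ℤ → T, (∀ u, P (fun n => c (n + u))) ∧ HasSlope c θ} := by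
  classical
  obtain ⟨N, ⟨e⟩⟩ := Finite.exists_equiv_fin T
  obtain ⟨t0⟩ := ‹Nonempty T›
  let mk : ({n // n ∈ W} → Fin N) → Pattern (Fin N) := fun f =>
    ⟨W, fun n => if h : n ∈ W then f ⟨n, h⟩ else e t0⟩
  let τ : TilingSystem (Fin N) :=
    ⟨Set.range mk ∩ {p | ¬ P (fun n => e.symm (p.data n))},
      (Set.finite_range mk).subset Set.inter_subset_left⟩
  have key : ∀ c : ℤ × ℤ → Fin N, τ.Valid c ↔ ∀ u, P (fun n => e.symm (c (n + u))) := by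
    intro c
    constructor
    · intro hv u
      by_contra hn
      let f : {n // n ∈ W} → Fin N := fun n => c (n.1 + u)
      have hm : mk f ∈ τ.F := by
        refine ⟨⟨f, rfl⟩, fun hp => hn (hP _ _ ?_ hp)⟩
        intro n hn
        simp [mk, f, hn]
      obtain ⟨n, hn1, hn2⟩ := hv _ hm u
      apply hn2
      have : n ∈ W := hn1
      simp [mk, f, this]
    · rintro h p ⟨⟨f, rfl⟩, hp⟩ u
      by_contra hn
      push Not at hn
      apply hp
      refine hP _ _ ?_ (h u)
      intro n hnW
      rw [hn n hnW]
  refine ⟨N, τ, ?_⟩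
  ext θ
  constructor
  · rintro ⟨c, hc, hs⟩
    exact ⟨fun x => e.symm (c x), (key c).1 hc, (hasSlope_comp_iff _ e.symm.injective c θ).2 hs⟩
  · rintro ⟨c, hc, hs⟩
    exact ⟨fun x => e (c x), (key _).2 (by simpa using hc),
      (hasSlope_comp_iff _ e.injective c θ).2 hs⟩

theorem isSlopeSet_empty : IsSlopeSet ∅ := by
  refine ⟨0, ⟨∅, Set.finite_empty⟩, ?_⟩
  ext θ
  simp only [Set.mem_empty_iff_false, iff_false]
  rintro ⟨c, -⟩
  exact (c 0).elim0

/-- The local predicate attached to a tiling system. -/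
theorem TilingSystem.exists_local {T : Type} (τ : TilingSystem T) :
    ∃ (W : Finset (ℤ × ℤ)) (P : (ℤ × ℤ → T) → Prop), LocalPred W P ∧
      ∀ c, τ.Valid c ↔ ∀ u, P (fun n => c (n + u)) := by
  classical
  refine ⟨τ.finite.toFinset.biUnion Pattern.support,
    fun a => ∀ p ∈ τ.F, ∃ n ∈ p.support, a n ≠ p.data n, ?_, ?_⟩
  · intro a b hab ha p hp
    obtain ⟨n, hn, h⟩ := ha p hp
    refine ⟨n, hn, ?_⟩
    rwa [← hab n]
    simp only [Finset.mem_biUnion, Set.Finite.mem_toFinset]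
    exact ⟨p, hp, hn⟩
  · intro c
    exact ⟨fun h u p hp => h p hp u, fun h p hp u => h u p hp⟩

theorem const_of_step {α : Type*} (f : ℤ × ℤ → α) (h1 : ∀ x, f (x + (1, 0)) = f x)
    (h2 : ∀ x, f (x + (0, 1)) = f x) (x y : ℤ × ℤ) : f x = f y := by
  have e1 : ∀ (n : ℤ) (a b : ℤ), f (a + n, b) = f (a, b) := by
    intro n
    induction n using Int.induction_on with
    | zero => simp
    | succ i ih =>
      intro a b
      rw [← ih a b, ← h1 (a + i, b)]; simp [add_assoc]
    | pred i ih =>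
      intro a b
      rw [← ih a b, ← h1 (a + (-i - 1), b)]; congr 2; simp; ring
  have e2 : ∀ (n : ℤ) (a b : ℤ), f (a, b + n) = f (a, b) := by
    intro n
    induction n using Int.induction_on with
    | zero => simp
    | succ i ih =>
      intro a b
      rw [← ih a b, ← h2 (a, b + i)]; simp [add_assoc]
    | pred i ih =>
      intro a b
      rw [← ih a b, ← h2 (a, b + (-i - 1))]; congr 2; simp; ring
  have := e1 (y.1 - x.1) x.1 x.2
  have h' := e2 (y.2 - x.2) y.1 x.2
  simp at this h'
  rw [← this, ← h']

theorem IsSlopeSet.union {S₁ S₂ : Set (Option ℚ)} (h₁ : IsSlopeSet S₁) (h₂ : IsSlopeSet S₂) :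
    IsSlopeSet (S₁ ∪ S₂) := by
  classical
  obtain ⟨N₁, τ₁, rfl⟩ := h₁
  obtain ⟨N₂, τ₂, rfl⟩ := h₂
  rcases Nat.eq_zero_or_pos N₁ with rfl | hN₁
  · have : τ₁.Slopes = ∅ := by
      ext θ
      simp only [Set.mem_empty_iff_false, iff_false]
      rintro ⟨c, -⟩
      exact (c 0).elim0
    rw [this, Set.empty_union]
    exact ⟨N₂, τ₂, rfl⟩
  rcases Nat.eq_zero_or_pos N₂ with rfl | hN₂
  · have : τ₂.Slopes = ∅ := by
      ext θ
      simp only [Set.mem_empty_iff_false, iff_false]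
      rintro ⟨c, -⟩
      exact (c 0).elim0
    rw [this, Set.union_empty]
    exact ⟨N₁, τ₁, rfl⟩
  obtain ⟨W₁, P₁, hP₁, hv₁⟩ := τ₁.exists_local
  obtain ⟨W₂, P₂, hP₂, hv₂⟩ := τ₂.exists_local
  let d₁ : Fin N₁ := ⟨0, hN₁⟩
  let d₂ : Fin N₂ := ⟨0, hN₂⟩
  let T := Fin N₁ ⊕ Fin N₂
  let f₁ : T → Fin N₁ := Sum.elim id (fun _ => d₁)
  let f₂ : T → Fin N₂ := Sum.elim (fun _ => d₂) id
  let P : (ℤ × ℤ → T) → Prop := fun a =>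
    (a (1, 0)).isLeft = (a 0).isLeft ∧ (a (0, 1)).isLeft = (a 0).isLeft ∧
    ((a 0).isLeft = true → P₁ (fun n => f₁ (a n))) ∧
    ((a 0).isLeft = false → P₂ (fun n => f₂ (a n)))
  have : Nonempty T := ⟨Sum.inl d₁⟩
  have hP : LocalPred (W₁ ∪ W₂ ∪ {(0, 0), (1, 0), (0, 1)}) P := by
    intro a b hab ⟨h1, h2, h3, h4⟩
    have e0 : a 0 = b 0 := hab (0, 0) (by simp)
    have e1 : a (1, 0) = b (1, 0) := hab _ (by simp)
    have e2 : a (0, 1) = b (0, 1) := hab _ (by simp)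
    refine ⟨by rw [← e0, ← e1]; exact h1, by rw [← e0, ← e2]; exact h2, ?_, ?_⟩
    · rw [← e0]
      intro h
      refine hP₁ _ _ ?_ (h3 h)
      intro n hn
      simp only [hab n (by simp [hn])]
    · rw [← e0]
      intro h
      refine hP₂ _ _ ?_ (h4 h)
      intro n hn
      simp only [hab n (by simp [hn])]
  have main := isSlopeSet_of_local _ P hP
  convert main using 1
  ext θ
  constructor
  · rintro (⟨c, hc, hs⟩ | ⟨c, hc, hs⟩)
    · refine ⟨fun x => Sum.inl (c x), fun u => ⟨rfl, rfl, fun _ => (hv₁ c).1 hc u, by simp⟩, ?_⟩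
      exact (hasSlope_comp_iff _ Sum.inl_injective c θ).2 hs
    · refine ⟨fun x => Sum.inr (c x), fun u => ⟨rfl, rfl, by simp, fun _ => (hv₂ c).1 hc u⟩, ?_⟩
      exact (hasSlope_comp_iff _ Sum.inr_injective c θ).2 hs
  · rintro ⟨c, hc, hs⟩
    have hconst : ∀ x, (c x).isLeft = (c 0).isLeft := by
      intro x
      refine const_of_step (fun x => (c x).isLeft) ?_ ?_ x 0
      · intro x
        have := (hc x).1
        simpa [add_comm] using this
      · intro x
        have := (hc x).2.1
        simpa [add_comm] using this
    cases h0 : (c 0).isLeft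
    · right
      have hr : ∀ x, c x = Sum.inr (f₂ (c x)) := by
        intro x
        have := hconst x
        rw [h0] at this
        cases hx : c x with
        | inl y => simp [hx] at this
        | inr y => simp [f₂]
      refine ⟨fun x => f₂ (c x), (hv₂ _).2 fun u => (hc u).2.2.2 ?_, ?_⟩
      · simp only [hconst, h0]
      · rw [← hasSlope_comp_iff _ Sum.inr_injective]
        convert hs using 1
        funext x
        exact (hr x).symm
    · left
      have hr : ∀ x, c x = Sum.inl (f₁ (c x)) := by
        intro x
        have := hconst x
        rw [h0] at this
        cases hx : c x with
        | inr y => simp [hx] at this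
        | inl y => simp [f₁]
      refine ⟨fun x => f₁ (c x), (hv₁ _).2 fun u => (hc u).2.2.1 ?_, ?_⟩
      · simp only [hconst, h0]
      · rw [← hasSlope_comp_iff _ Sum.inl_injective]
        convert hs using 1
        funext x
        exact (hr x).symm

/-- Exchange of the two axes, on directions. -/
def swapDir : Option ℚ → Option ℚ
  | none => some 0
  | some r => if r = 0 then none else some r⁻¹

theorem swapDir_swapDir (θ : Option ℚ) : swapDir (swapDir θ) = θ := by
  cases θ with
  | none => simp [swapDir]
  | some r =>
    by_cases h : r = 0 <;> simp [swapDir, h]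

theorem dir_swap (v : ℤ × ℤ) (hv : v ≠ 0) : dir v.swap = swapDir (dir v) := by
  obtain ⟨a, b⟩ := v
  by_cases ha : a = 0
  · have hb : b ≠ 0 := by rintro rfl; exact hv (by simp [ha])
    simp [dir, ha, hb, swapDir]
  · by_cases hb : b = 0 <;> simp [dir, ha, hb, swapDir]

theorem isPeriod_swap {T : Type} (c : ℤ × ℤ → T) (v : ℤ × ℤ) :
    IsPeriod (fun x => c x.swap) v ↔ IsPeriod c v.swap := by
  constructor
  · intro h x
    have := h x.swap
    simpa using this
  · intro h x
    have := h x.swap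
    simpa using this

theorem hasSlope_swap {T : Type} (c : ℤ × ℤ → T) (θ : Option ℚ) (h : HasSlope c θ) :
    HasSlope (fun x => c x.swap) (swapDir θ) := by
  obtain ⟨⟨v, hv, hp, hd⟩, hall⟩ := h
  have sw : ∀ v : ℤ × ℤ, v ≠ 0 → v.swap ≠ 0 := by
    intro v hv h
    apply hv
    have := congrArg Prod.swap h
    simpa using this
  refine ⟨⟨v.swap, sw v hv, ?_, ?_⟩, ?_⟩
  · rw [isPeriod_swap]; simpa using hp
  · rw [dir_swap v hv, hd]
  · intro u hu hpu
    rw [isPeriod_swap] at hpu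
    have := hall _ (sw u hu) hpu
    rw [← this, ← dir_swap _ (sw u hu)]
    simp

theorem IsSlopeSet.swap {S : Set (Option ℚ)} (h : IsSlopeSet S) :
    IsSlopeSet {θ | swapDir θ ∈ S} := by
  classical
  obtain ⟨N, τ, rfl⟩ := h
  rcases Nat.eq_zero_or_pos N with rfl | hN
  · convert isSlopeSet_empty using 1
    ext θ
    simp only [Set.mem_ofPred_eq, Set.mem_empty_iff_false, iff_false]
    rintro ⟨c, -⟩
    exact (c 0).elim0
  obtain ⟨W, P, hP, hv⟩ := τ.exists_local
  have : Nonempty (Fin N) := ⟨⟨0, hN⟩⟩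
  have main := isSlopeSet_of_local (W.image Prod.swap) (fun a => P (fun n => a n.swap)) (by
    intro a b hab ha
    refine hP _ _ ?_ ha
    intro n hn
    apply hab
    exact Finset.mem_image_of_mem _ hn)
  convert main using 1
  ext θ
  constructor
  · rintro ⟨c, hc, hs⟩
    refine ⟨fun x => c x.swap, ?_, ?_⟩
    · intro u
      have := (hv c).1 hc u.swap
      simpa using this
    · have := hasSlope_swap _ _ hs
      rwa [swapDir_swapDir] at this
  · rintro ⟨c, hc, hs⟩
    refine ⟨fun x => c x.swap, ?_, hasSlope_swap _ _ hs⟩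
    rw [hv]
    intro u
    have := hc u.swap
    simpa using this


/-! ### Part 2: multiplication layer (an aperiodic device in the spirit of Kari) -/

theorem dir_eq_iff (v w : ℤ × ℤ) (hv : v ≠ 0) (hw : w ≠ 0) :
    dir v = dir w ↔ v.1 * w.2 = w.1 * v.2 := by
  obtain ⟨a, b⟩ := v
  obtain ⟨x, y⟩ := w
  by_cases ha : a = 0
  · subst ha
    have hb : b ≠ 0 := by rintro rfl; exact hv rfl
    by_cases hx : x = 0
    · simp [dir, hx]
    · simp [dir, hx, hb]
  · by_cases hx : x = 0
    · subst hx
      have hy : y ≠ 0 := by rintro rfl; exact hw rfl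
      simp [dir, ha, hy]
    · have ha' : (a : ℚ) ≠ 0 := by exact_mod_cast ha
      have hx' : (x : ℚ) ≠ 0 := by exact_mod_cast hx
      simp only [dir, ha, hx, if_false, Option.some.injEq]
      rw [div_eq_div_iff ha' hx']
      constructor
      · intro h
        have : b * x = y * a := by exact_mod_cast h
        linarith
      · intro h
        have : b * x = y * a := by linarith
        exact_mod_cast this

/-- If a row total is multiplied `q` times by `2` or `2/3` up to bounded errors and comes back to
itself up to a bounded error, then it is bounded. -/
theorem kari_bound (q : ℕ) (hq : 0 < q) (F : ℤ) (m S : ℕ → ℤ)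
    (hm : ∀ r, m r = 1 ∨ m r = 3) (hS : ∀ r < q, |m r * S (r + 1) - 2 * S r| ≤ 3)
    (hF : |S q - S 0| ≤ F) (h0 : 0 ≤ S 0) : S 0 ≤ 3 ^ q * F + q * 3 ^ (q + 1) := by
  have hodd : ∀ j, (∏ r ∈ Finset.range j, m r) % 2 = 1 := by
    intro j
    induction j with
    | zero => simp
    | succ j ih =>
      rw [Finset.prod_range_succ, Int.mul_emod, ih]
      rcases hm j with h | h <;> simp [h]
  have hle : ∀ j, 1 ≤ (∏ r ∈ Finset.range j, m r) ∧ (∏ r ∈ Finset.range j, m r) ≤ 3 ^ j := by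
    intro j
    induction j with
    | zero => simp
    | succ j ih =>
      rw [Finset.prod_range_succ, pow_succ]
      rcases hm j with h | h <;> rw [h] <;> constructor <;> nlinarith [ih.1, ih.2]
  have hE : ∀ j ≤ q, |(∏ r ∈ Finset.range j, m r) * S j - 2 ^ j * S 0| ≤ j * 3 ^ (j + 1) := by
    intro j
    induction j with
    | zero => simp
    | succ j ih =>
      intro hj
      have h1 := ih (by omega)
      have h2 := hS j (by omega)
      obtain ⟨p1, p2⟩ := hle j
      rw [Finset.prod_range_succ]
      set Pj := ∏ r ∈ Finset.range j, m r
      have e : Pj * m j * S (j + 1) - 2 ^ (j + 1) * S 0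
          = Pj * (m j * S (j + 1) - 2 * S j) + 2 * (Pj * S j - 2 ^ j * S 0) := by ring
      rw [e]
      have h3 : |Pj * (m j * S (j + 1) - 2 * S j)| ≤ 3 ^ j * 3 := by
        rw [abs_mul, abs_of_pos (by omega : (0 : ℤ) < Pj)]
        exact mul_le_mul p2 h2 (abs_nonneg _) (by positivity)
      have h4 : |2 * (Pj * S j - 2 ^ j * S 0)| ≤ 2 * (j * 3 ^ (j + 1)) := by
        rw [abs_mul]; simpa using h1
      have h5 := abs_add_le (Pj * (m j * S (j + 1) - 2 * S j)) (2 * (Pj * S j - 2 ^ j * S 0))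
      have h6 : (0 : ℤ) ≤ j * 3 ^ j := by positivity
      have h7 : (0 : ℤ) ≤ 3 ^ j := by positivity
      push_cast
      have : ((j : ℤ) + 1) * 3 ^ (j + 1 + 1) = 9 * (j * 3 ^ j) + 9 * 3 ^ j := by ring
      rw [this]
      have : 2 * ((j : ℤ) * 3 ^ (j + 1)) = 6 * (j * 3 ^ j) := by ring
      linarith
  have hq' := hE q le_rfl
  obtain ⟨p1, p2⟩ := hle q
  have po := hodd q
  set Pq := ∏ r ∈ Finset.range q, m r
  have hne : Pq ≠ 2 ^ q := by
    intro h
    have : (2 : ℤ) ^ q % 2 = 0 := by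
      obtain ⟨k, rfl⟩ : ∃ k, q = k + 1 := ⟨q - 1, by omega⟩
      rw [pow_succ]; simp
    omega
  have h1 : 1 ≤ |Pq - 2 ^ q| := Int.one_le_abs (sub_ne_zero.2 hne)
  have h2 : |(Pq - 2 ^ q) * S 0| ≤ 3 ^ q * F + q * 3 ^ (q + 1) := by
    have e : (Pq - 2 ^ q) * S 0 = -(Pq * (S q - S 0)) + (Pq * S q - 2 ^ q * S 0) := by ring
    rw [e]
    refine (abs_add_le _ _).trans (add_le_add ?_ hq')
    rw [abs_neg, abs_mul, abs_of_pos (by omega : (0 : ℤ) < Pq)]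
    exact mul_le_mul p2 hF (abs_nonneg _) (by positivity)
  rw [abs_mul, abs_of_nonneg h0] at h2
  nlinarith

/-- Orbit of a real number of `[1, 3]` under the map which multiplies by `2` or by `2/3`. -/
noncomputable def kAlpha : ℕ → ℝ
  | 0 => 1
  | r + 1 => if kAlpha r ≤ 3 / 2 then 2 * kAlpha r else 2 * kAlpha r / 3

theorem kAlpha_mem (r : ℕ) : 1 ≤ kAlpha r ∧ kAlpha r ≤ 3 := by
  induction r with
  | zero => simp [kAlpha]
  | succ r ih =>
    simp only [kAlpha]
    split_ifs with h
    · constructor <;> linarith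
    · constructor <;> linarith

/-- The digit (minus one) is stored as an element of `Fin 3`, the carry (plus one) as an element
of `Fin 4`. -/
def kariRule (a : Bool) (b : Fin 3) (c : Fin 4) (c' : Fin 4) (b' : Fin 3) : Prop :=
  2 * ((b : ℤ) + 1) + c = (if a then 1 else 3) * ((b' : ℤ) + 1) + c'

noncomputable def kA (r i : ℕ) : ℤ := ⌊(i : ℝ) * kAlpha r⌋

noncomputable def kLam (r : ℕ) : Bool := open Classical in decide (kAlpha r ≤ 3 / 2)

noncomputable def kDig (r i : ℕ) : Fin 3 := Fin.ofNat 3 (kA r (i + 1) - kA r i - 1).toNat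

noncomputable def kCar (r i : ℕ) : Fin 4 :=
  Fin.ofNat 4 (2 * kA r i - (if kLam r then 1 else 3) * kA (r + 1) i + 1).toNat

theorem kDig_val (r i : ℕ) : ((kDig r i : Fin 3) : ℤ) + 1 = kA r (i + 1) - kA r i := by
  have h := kAlpha_mem r
  have h1 : 1 ≤ kA r (i + 1) - kA r i ∧ kA r (i + 1) - kA r i ≤ 3 := by
    unfold kA
    push_cast
    set x := kAlpha r
    have a1 := Int.floor_le ((i : ℝ) * x)
    have a2 := Int.lt_floor_add_one ((i : ℝ) * x)
    have a3 := Int.floor_le (((i : ℝ) + 1) * x)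
    have a4 := Int.lt_floor_add_one (((i : ℝ) + 1) * x)
    constructor
    · have : ⌊(i : ℝ) * x⌋ + 1 ≤ ⌊((i : ℝ) + 1) * x⌋ := by
        rw [Int.le_floor]; push_cast; nlinarith
      linarith
    · have : ⌊((i : ℝ) + 1) * x⌋ < ⌊(i : ℝ) * x⌋ + 4 := by
        rw [Int.floor_lt]; push_cast; nlinarith
      linarith
  unfold kDig
  simp only [Fin.ofNat, Fin.val_mk]
  omega

theorem kCar_val (r i : ℕ) :
    ((kCar r i : Fin 4) : ℤ) = 2 * kA r i - (if kLam r then 1 else 3) * kA (r + 1) i + 1 := by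
  have h1 : -1 ≤ 2 * kA r i - (if kLam r then 1 else 3) * kA (r + 1) i ∧
      2 * kA r i - (if kLam r then 1 else 3) * kA (r + 1) i ≤ 2 := by
    unfold kA kLam
    by_cases h : kAlpha r ≤ 3 / 2
    · have e : kAlpha (r + 1) = 2 * kAlpha r := by simp [kAlpha, h]
      simp only [h, e, decide_true, if_true]
      have e2 : (i : ℝ) * (2 * kAlpha r) = 2 * (i * kAlpha r) := by ring
      rw [e2]
      set x := (i : ℝ) * kAlpha r
      have a1 := Int.floor_le x
      have a2 := Int.lt_floor_add_one x
      have b1 : 2 * ⌊x⌋ ≤ ⌊2 * x⌋ := by rw [Int.le_floor]; push_cast; linarith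
      have b2 : ⌊2 * x⌋ < 2 * ⌊x⌋ + 2 := by rw [Int.floor_lt]; push_cast; linarith
      constructor <;> linarith
    · have e : kAlpha (r + 1) = 2 * kAlpha r / 3 := by simp [kAlpha, h]
      simp only [h, e, decide_false]
      have e2 : (i : ℝ) * (2 * kAlpha r / 3) = 2 * (i * kAlpha r) / 3 := by ring
      rw [e2]
      set x := (i : ℝ) * kAlpha r
      have a1 := Int.floor_le x
      have a2 := Int.lt_floor_add_one x
      have a3 := Int.floor_le (2 * x / 3)
      have a4 := Int.lt_floor_add_one (2 * x / 3)
      have b1 : 2 * ⌊x⌋ < 3 * ⌊2 * x / 3⌋ + 3 := by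
        have : (2 * ⌊x⌋ : ℝ) < 3 * ⌊2 * x / 3⌋ + 3 := by linarith
        exact_mod_cast this
      have b2 : 3 * ⌊2 * x / 3⌋ < 2 * ⌊x⌋ + 2 := by
        have : (3 * ⌊2 * x / 3⌋ : ℝ) < 2 * ⌊x⌋ + 2 := by linarith
        exact_mod_cast this
      simp only [Bool.false_eq_true, if_false]
      constructor <;> linarith
  unfold kCar
  simp only [Fin.ofNat, Fin.val_mk]
  omega

theorem kari_ok (r i : ℕ) :
    kariRule (kLam r) (kDig r i) (kCar r i) (kCar r (i + 1)) (kDig (r + 1) i) := by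
  unfold kariRule
  rw [kDig_val, kDig_val, kCar_val, kCar_val]
  ring


/-! ### Part 3: strips -/

/-- Tiles of the strip system. -/
inductive STile (G K : Type) : Type
  | L : STile G K
  | R : STile G K
  | C (g : G) (k : K) : STile G K

namespace STile

variable {G K : Type}

def kOf : STile G K → Option K
  | L => none
  | R => none
  | C _ k => some k

def dOf (d : G → ℤ) : STile G K → ℤ
  | L => 0
  | R => 0
  | C g _ => d g

def rank : STile G K → ℕ
  | L => 0
  | C _ _ => 1
  | R => 2

def IsC (t : STile G K) : Prop := t.rank = 1

theorem isC_iff (t : STile G K) : t.IsC ↔ ∃ g k, t = C g k := by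
  cases t <;> simp [IsC, rank]

theorem kOf_eq_none (t : STile G K) : t.kOf = none ↔ ¬ t.IsC := by
  cases t <;> simp [IsC, rank, kOf]

instance [Finite G] [Finite K] : Finite (STile G K) := by
  let f : STile G K → Option (Option (G × K)) := fun t =>
    match t with
    | L => none
    | R => some none
    | C g k => some (some (g, k))
  apply Finite.of_injective f
  intro a b h
  cases a <;> cases b <;> simp_all [f]

instance : Nonempty (STile G K) := ⟨L⟩

end STile

open STile

/-- The local condition of the strip system, at the cell `(x, r)`. -/
structure StripCond {G K : Type} (d : G → ℤ) (Φ : G → G → Option K → K → Option K → K → Prop)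
    (c : ℤ → ℤ → STile G K) (x r : ℤ) : Prop where
  hL1 : c x r = L → c (x + 1) r ≠ R
  hL2 : c x r = L → c x (r + 1) ≠ R
  hR1 : c x r = R → c (x + 1) r = R
  hR2 : c x r = R → c x (r + 1) ≠ L
  hC1 : (c x r).IsC → c (x + 1) r ≠ L
  hC2 : ∀ g k g' k', c x r = C g k → c (x + 1) r = C g' k' → g' = g
  hC3 : ∀ g k, c x r = C g k → ∃ g' k', c (x + d g) (r + 1) = C g' k' ∧
    ((c (x - 1) r).IsC ↔ (c (x + d g - 1) (r + 1)).IsC) ∧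
    ((c (x + 1) r).IsC ↔ (c (x + d g + 1) (r + 1)).IsC) ∧
    Φ g g' (c (x - 1) r).kOf k (c (x + 1) r).kOf k'

/-- Runs of the row machine on a finite zone. -/
def Run {G K : Type} (Φ : G → G → Option K → K → Option K → K → Prop) (w : ℕ) (g : ℕ → G)
    (k : ℕ → ℕ → K) : Prop :=
  ∀ r i, i < w → Φ (g r) (g (r + 1)) (if i = 0 then none else some (k r (i - 1))) (k r i)
    (if i + 1 < w then some (k r (i + 1)) else none) (k (r + 1) i)

section Sound

variable {G K : Type} {d : G → ℤ} {Φ : G → G → Option K → K → Option K → K → Prop}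
  {c : ℤ → ℤ → STile G K}

theorem strip_mono (h : ∀ x r, StripCond d Φ c x r) (r x : ℤ) (n : ℕ) :
    (c x r).rank ≤ (c (x + n) r).rank := by
  induction n with
  | zero => simp
  | succ n ih =>
    refine ih.trans ?_
    have h1 := (h (x + n) r).hL1
    have h2 := (h (x + n) r).hR1
    have h3 := (h (x + n) r).hC1
    push_cast
    rw [← add_assoc]
    generalize c (x + n) r = a at *
    generalize c (x + n + 1) r = b at *
    cases a <;> cases b <;> simp_all [rank, IsC]

theorem strip_mono' (h : ∀ x r, StripCond d Φ c x r) (r : ℤ) {x y : ℤ} (hxy : x ≤ y) :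
    (c x r).rank ≤ (c y r).rank := by
  have := strip_mono h r x (y - x).toNat
  rwa [Int.toNat_of_nonneg (by omega), add_sub_cancel] at this

theorem strip_between (h : ∀ x r, StripCond d Φ c x r) (r : ℤ) {x y z : ℤ} (hxy : x ≤ y)
    (hyz : y ≤ z) (hx : (c x r).IsC) (hz : (c z r).IsC) : (c y r).IsC := by
  have h1 := strip_mono' h r hxy
  have h2 := strip_mono' h r hyz
  unfold IsC at *
  omega

/-- On a run of consecutive `C` cells, the global state is constant. -/
theorem strip_const (h : ∀ x r, StripCond d Φ c x r) (r x : ℤ) (n : ℕ)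
    (hC : ∀ i : ℕ, i < n → (c (x + i) r).IsC) (g : G) (k : K) (hg : c x r = C g k) (i : ℕ)
    (hi : i < n) : ∃ k', c (x + i) r = C g k' := by
  induction i with
  | zero => exact ⟨k, by simpa using hg⟩
  | succ i ih =>
    obtain ⟨k', hk'⟩ := ih (by omega)
    obtain ⟨g'', k'', h''⟩ := (isC_iff _).1 (hC (i + 1) hi)
    refine ⟨k'', ?_⟩
    push_cast at h'' ⊢
    rw [← add_assoc] at h'' ⊢
    rw [h'', (h (x + i) r).hC2 _ _ _ _ hk' h'']

theorem sum_shift_aux (f : ℤ → ℤ) (hf : ∀ x, 0 ≤ f x ∧ f x ≤ 3) (N : ℕ) (x : ℤ) (n : ℕ) :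
    |∑ i ∈ Finset.range N, f (x + n + i) - ∑ i ∈ Finset.range N, f (x + i)| ≤ 3 * n := by
  induction n with
  | zero => simp
  | succ n ih =>
    have e : ∑ i ∈ Finset.range N, f (x + (n + 1 : ℕ) + i)
        = ∑ i ∈ Finset.range N, f (x + n + i) + f (x + n + N) - f (x + n) := by
      have h1 := Finset.sum_range_succ (fun i : ℕ => f (x + n + i)) N
      have h2 := Finset.sum_range_succ' (fun i : ℕ => f (x + n + i)) N
      simp only [Nat.cast_zero, add_zero] at h2
      have h3 : ∑ i ∈ Finset.range N, f (x + (n + 1 : ℕ) + i)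
        = ∑ i ∈ Finset.range N, f (x + n + (i + 1 : ℕ)) :=
        Finset.sum_congr rfl (fun i _ => by congr 1; push_cast; ring)
      rw [h3]; linarith
    rw [e]
    have := hf (x + n + N)
    have := hf (x + n)
    rw [abs_le] at ih ⊢
    push_cast
    constructor <;> linarith

theorem sum_shift (f : ℤ → ℤ) (hf : ∀ x, 0 ≤ f x ∧ f x ≤ 3) (N : ℕ) (x y : ℤ) :
    |∑ i ∈ Finset.range N, f (y + i) - ∑ i ∈ Finset.range N, f (x + i)| ≤ 3 * |y - x| := by
  rcases le_total x y with h | h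
  · have := sum_shift_aux f hf N x (y - x).toNat
    rw [Int.toNat_of_nonneg (by omega), add_sub_cancel] at this
    rwa [abs_of_nonneg (a := y - x) (by omega)]
  · have := sum_shift_aux f hf N y (x - y).toNat
    rw [Int.toNat_of_nonneg (by omega), add_sub_cancel] at this
    rw [abs_sub_comm, abs_sub_comm y x]
    rwa [abs_of_nonneg (a := x - y) (by omega)]

theorem strip_step (h : ∀ x r, StripCond d Φ c x r) (r x : ℤ) (n : ℕ)
    (hC : ∀ i : ℕ, i < n → (c (x + i) r).IsC) (hn : 0 < n) (i : ℕ) (hi : i < n) :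
    (c (x + dOf d (c x r) + i) (r + 1)).IsC := by
  obtain ⟨g, k, hg⟩ := (isC_iff _).1 (hC 0 hn)
  simp only [Nat.cast_zero, add_zero] at hg
  obtain ⟨k', hk'⟩ := strip_const h r x n hC g k hg i hi
  obtain ⟨g', k'', h', -⟩ := (h _ _).hC3 _ _ hk'
  rw [isC_iff]
  refine ⟨g', k'', ?_⟩
  rw [← h', hg]
  congr 1
  simp [dOf]; ring

/-- Consequence of the Kari layer: rows recurring up to a shift have bounded intervals. -/
theorem strip_bounded (h : ∀ x r, StripCond d Φ c x r) (M : ℤ) (hM : ∀ g, |d g| ≤ M)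
    (lam : G → Bool) (dig : K → Fin 3) (car : K → Fin 4)
    (hΦ : ∀ g g' a k b k', Φ g g' a k (some b) k' →
      kariRule (lam g) (dig k) (car k) (car b) (dig k'))
    (r p : ℤ) (q : ℕ) (hq : 0 < q) (hp : ∀ x, c (x + p) (r + q) = c x r) :
    ∃ B : ℕ, ∀ (x : ℤ) (n : ℕ), (∀ i : ℕ, i < n → (c (x + i) r).IsC) → n ≤ B := by
  have hM0 : q = 0 ∨ 0 ≤ M ∨ IsEmpty G := by
    rcases isEmpty_or_nonempty G with h | ⟨⟨g⟩⟩
    · exact Or.inr (Or.inr h)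
    · exact Or.inr (Or.inl ((abs_nonneg _).trans (hM g)))
  let F : ℤ := 3 * (q * |M| + |p|)
  refine ⟨(3 ^ q * F + q * 3 ^ (q + 1)).toNat + 1, fun x n hC => ?_⟩
  rcases n with _ | n
  · omega
  let X : ℕ → ℤ := fun j => Nat.rec x (fun j y => y + dOf d (c y (r + j))) j
  have X0 : X 0 = x := rfl
  have XS : ∀ j, X (j + 1) = X j + dOf d (c (X j) (r + j)) := fun j => rfl
  have XC : ∀ j, ∀ i : ℕ, i < n + 1 → (c (X j + i) (r + j)).IsC := by
    intro j
    induction j with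
    | zero => simpa [X0] using hC
    | succ j ih =>
      intro i hi
      have := strip_step h (r + j) (X j) (n + 1) ih (by omega) i hi
      rw [XS]; push_cast; rwa [← add_assoc]
  let f : STile G K → ℤ := fun t => match t with
    | L => 0
    | R => 0
    | C _ k => (dig k : ℤ) + 1
  have hf : ∀ t, 0 ≤ f t ∧ f t ≤ 3 := by
    intro t
    cases t with
    | L => simp [f]
    | R => simp [f]
    | C g k => have := (dig k).isLt; simp only [f]; omega
  let m : ℕ → ℤ := fun j => match c (X j) (r + j) with
    | L => 1
    | R => 1
    | C g k => if lam g then 1 else 3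
  let S : ℕ → ℤ := fun j => ∑ i ∈ Finset.range n, f (c (X j + i) (r + j))
  have hXb : ∀ j, |X j - x| ≤ j * |M| := by
    intro j
    induction j with
    | zero => simp [X0]
    | succ j ih =>
      rw [XS]
      have : |dOf d (c (X j) (r + j))| ≤ |M| := by
        cases c (X j) (r + j) with
        | L => simp [dOf]
        | R => simp [dOf]
        | C g k => exact (hM g).trans (le_abs_self M)
      push_cast
      calc |X j + dOf d (c (X j) (r + j)) - x| = |(X j - x) + dOf d (c (X j) (r + j))| := by
            congr 1; ring
        _ ≤ _ := abs_add_le _ _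
        _ ≤ _ := by linarith
  have key := kari_bound q hq F m S ?_ ?_ ?_ ?_
  · have hS0 : (n : ℤ) ≤ S 0 := by
      have : ∑ i ∈ Finset.range n, (1 : ℤ) ≤ S 0 := by
        apply Finset.sum_le_sum
        intro i hi
        obtain ⟨g, k, hk⟩ := (isC_iff _).1 (XC 0 i (by simp at hi; omega))
        rw [hk]; simp [f]
      simpa using this
    omega
  · intro j
    simp only [m]
    cases c (X j) (r + j) with
    | L => simp
    | R => simp
    | C g k => cases lam g <;> simp
  · intro j hj
    obtain ⟨g, k, hg⟩ := (isC_iff _).1 (XC j 0 (by omega))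
    simp only [Nat.cast_zero, add_zero] at hg
    let e : STile G K → ℤ := fun t => match t with
      | L => 0
      | R => 0
      | C _ k => (car k : ℤ)
    have he : ∀ t, 0 ≤ e t ∧ e t ≤ 3 := by
      intro t
      cases t with
      | L => simp [e]
      | R => simp [e]
      | C g k => have := (car k).isLt; simp only [e]; omega
    have hk : ∀ i ∈ Finset.range n, m j * f (c (X (j + 1) + i) (r + (j + 1 : ℕ)))
        - 2 * f (c (X j + i) (r + j)) = - (e (c (X j + (i + 1 : ℕ)) (r + j)) - e (c (X j + i) (r + j))) := by
      intro i hi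
      have hi := Finset.mem_range.1 hi
      obtain ⟨k1, hk1⟩ := strip_const h _ _ _ (XC j) g k hg i (by omega)
      obtain ⟨k2, hk2⟩ := strip_const h _ _ _ (XC j) g k hg (i + 1) (by omega)
      obtain ⟨g', k3, hk3, -, -, h4⟩ := (h _ _).hC3 _ _ hk1
      have e1 : X j + i + 1 = X j + (i + 1 : ℕ) := by push_cast; ring
      have e2 : X j + i + d g = X (j + 1) + i := by rw [XS, hg]; simp [dOf]; ring
      have e3 : r + j + 1 = r + (j + 1 : ℕ) := by push_cast; ring
      rw [e2, e3] at hk3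
      rw [e1, hk2] at h4
      have := hΦ _ _ _ _ _ _ h4
      rw [hk3, hk1, hk2]
      simp only [m, f, e, hg]
      unfold kariRule at this
      linarith
    have hs := Finset.sum_congr rfl hk
    rw [Finset.sum_sub_distrib, ← Finset.mul_sum, ← Finset.mul_sum, Finset.sum_neg_distrib,
      Finset.sum_range_sub (fun i : ℕ => e (c (X j + i) (r + j)))] at hs
    rw [show m j * S (j + 1) - 2 * S j = _ from hs]
    have h1 := he (c (X j + n) (r + j))
    have h2 := he (c (X j + (0 : ℕ)) (r + j))
    rw [abs_le]; constructor <;> linarith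
  · have := sum_shift (fun y => f (c y r)) (fun y => hf _) n x (X q - p)
    have e1 : S q = ∑ i ∈ Finset.range n, f (c (X q - p + i) r) := by
      apply Finset.sum_congr rfl
      intro i _
      rw [← hp]; congr 2; ring
    have e2 : S 0 = ∑ i ∈ Finset.range n, f (c (x + i) r) := by
      simp [S, X0]
    rw [e1, e2]
    refine this.trans ?_
    have h1 := hXb q
    have h2 : |X q - p - x| ≤ |X q - x| + |p| := by
      rw [show X q - p - x = (X q - x) - p by ring]
      exact abs_sub _ _
    simp only [F]
    linarith
  · exact Finset.sum_nonneg (fun i _ => (hf _).1)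

end Sound


open STile

section Sound2

variable {G K : Type} {d : G → ℤ} {Φ : G → G → Option K → K → Option K → K → Prop}
  {c : ℤ → ℤ → STile G K}

/-- `[x, x + w)` is exactly a maximal interval of `C` cells in row `r`. -/
def Zone (c : ℤ → ℤ → STile G K) (x r : ℤ) (w : ℕ) : Prop :=
  (∀ i : ℕ, i < w → (c (x + i) r).IsC) ∧ ¬ (c (x - 1) r).IsC ∧ ¬ (c (x + w) r).IsC

theorem zone_unique (h : ∀ x r, StripCond d Φ c x r) {x y r : ℤ} {w w' : ℕ} (hx : Zone c x r w)
    (hy : Zone c y r w') (hw : 0 < w) (hw' : 0 < w') : x = y := by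
  have hx0 := hx.1 0 hw
  have hy0 := hy.1 0 hw'
  simp only [Nat.cast_zero, add_zero] at hx0 hy0
  rcases lt_trichotomy x y with h1 | h1 | h1
  · exact (hy.2.1 (strip_between h r (by omega) (by omega : y - 1 ≤ y) hx0 hy0)).elim
  · exact h1
  · exact (hx.2.1 (strip_between h r (by omega) (by omega : x - 1 ≤ x) hy0 hx0)).elim

theorem zone_step (h : ∀ x r, StripCond d Φ c x r) {x r : ℤ} {w : ℕ} (hx : Zone c x r w)
    (hw : 0 < w) : Zone c (x + dOf d (c x r)) (r + 1) w := by
  obtain ⟨g, k, hg⟩ := (isC_iff _).1 (hx.1 0 hw)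
  simp only [Nat.cast_zero, add_zero] at hg
  refine ⟨fun i hi => strip_step h r x w hx.1 hw i hi, ?_, ?_⟩
  · obtain ⟨_, _, _, h1, -⟩ := (h _ _).hC3 _ _ hg
    rw [hg]
    exact fun h2 => hx.2.1 (h1.2 h2)
  · obtain ⟨k', hk'⟩ := strip_const h r x w hx.1 g k hg (w - 1) (by omega)
    obtain ⟨_, _, _, -, h1, -⟩ := (h _ _).hC3 _ _ hk'
    have e : ((w - 1 : ℕ) : ℤ) = w - 1 := by omega
    rw [hg]
    intro h2
    apply hx.2.2
    have h3 := h1.2 (by convert h2 using 2; simp only [dOf, e]; ring)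
    convert h3 using 2
    rw [e]; ring

theorem zone_exists {r x : ℤ} (hx : (c x r).IsC) (B : ℕ)
    (hB : ∀ (x : ℤ) (n : ℕ), (∀ i : ℕ, i < n → (c (x + i) r).IsC) → n ≤ B) :
    ∃ l w, 0 < w ∧ Zone c l r w := by
  classical
  have h1 : ∃ n : ℕ, ¬ (c (x - n) r).IsC := by
    by_contra hn
    push Not at hn
    have := hB (x - B) (B + 1) (fun i hi => by
      have := hn (B - i)
      convert this using 2
      push_cast [show i ≤ B by omega]; ring)
    omega
  have h2 : ∃ n : ℕ, ¬ (c (x + n) r).IsC := by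
    by_contra hn
    push Not at hn
    have := hB x (B + 1) (fun i hi => hn i)
    omega
  obtain ⟨a, ha, ha'⟩ : ∃ a : ℕ, ¬ (c (x - a) r).IsC ∧ ∀ m : ℕ, m < a → (c (x - m) r).IsC :=
    ⟨Nat.find h1, Nat.find_spec h1, fun m hm => not_not.1 (Nat.find_min h1 hm)⟩
  obtain ⟨b, hb, hb'⟩ : ∃ a : ℕ, ¬ (c (x + a) r).IsC ∧ ∀ m : ℕ, m < a → (c (x + m) r).IsC :=
    ⟨Nat.find h2, Nat.find_spec h2, fun m hm => not_not.1 (Nat.find_min h2 hm)⟩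
  have ha0 : 0 < a := by
    rcases Nat.eq_zero_or_pos a with rfl | h
    · simp [hx] at ha
    · exact h
  have hb0 : 0 < b := by
    rcases Nat.eq_zero_or_pos b with rfl | h
    · simp [hx] at hb
    · exact h
  refine ⟨x - a + 1, a + b - 1, by omega, ?_, ?_, ?_⟩
  · intro i hi
    by_cases hia : i + 1 < a
    · have := ha' (a - 1 - i) (by omega)
      convert this using 2
      omega
    · have := hb' (i + 1 - a) (by omega)
      convert this using 2
      omega
  · convert ha using 3; ring
  · convert hb using 3; omega

theorem isPeriod_neg {T : Type} {c : ℤ × ℤ → T} {v : ℤ × ℤ} (h : IsPeriod c v) :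
    IsPeriod c (-v) := by
  intro x
  have := h (x + -v)
  simpa using this.symm

theorem dir_neg (v : ℤ × ℤ) : dir (-v) = dir v := by
  simp [dir]

theorem isPeriod_nsmul {T : Type} {c : ℤ × ℤ → T} {v : ℤ × ℤ} (h : IsPeriod c v) (n : ℕ) :
    IsPeriod c (n • v) := by
  induction n with
  | zero => intro x; simp
  | succ n ih =>
    intro x
    rw [add_smul, one_smul, ← add_assoc, h, ih]

theorem strip_sound [Finite G] [Finite K] (h : ∀ x r, StripCond d Φ c x r) (M : ℤ) (hM : ∀ g, |d g| ≤ M)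
    (lam : G → Bool) (dig : K → Fin 3) (car : K → Fin 4)
    (hΦ : ∀ g g' a k b k', Φ g g' a k (some b) k' →
      kariRule (lam g) (dig k) (car k) (car b) (dig k'))
    (θ : Option ℚ) (hθ : HasSlope (fun x : ℤ × ℤ => c x.1 x.2) θ) :
    ∃ w, 0 < w ∧ ∃ (g : ℕ → G) (k : ℕ → ℕ → K) (q : ℕ), 0 < q ∧ Run Φ w g k ∧
      (∀ r, g (r + q) = g r) ∧ (∀ r i, i < w → k (r + q) i = k r i) ∧
      θ = dir (∑ r ∈ Finset.range q, d (g r), (q : ℤ)) := by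
  -- there is a `C` cell
  have hex : ∃ x r, (c x r).IsC := by
    by_contra hn
    push Not at hn
    have p1 : IsPeriod (fun x : ℤ × ℤ => c x.1 x.2) (1, 0) := by
      intro ⟨x, r⟩
      simp only [Prod.mk_add_mk, add_zero]
      have h1 := (h x r).hL1
      have h2 := (h x r).hR1
      have h3 := hn x r
      have h4 := hn (x + 1) r
      generalize c x r = a at *
      generalize c (x + 1) r = b at *
      cases a <;> cases b <;> simp_all [IsC, rank]
    have p2 : IsPeriod (fun x : ℤ × ℤ => c x.1 x.2) (0, 1) := by
      intro ⟨x, r⟩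
      simp only [Prod.mk_add_mk, add_zero]
      have h1 := (h x r).hL2
      have h2 := (h x r).hR2
      have h3 := hn x r
      have h4 := hn x (r + 1)
      generalize c x r = a at *
      generalize c x (r + 1) = b at *
      cases a <;> cases b <;> simp_all [IsC, rank]
    have := (hθ.2 _ (by simp) p1).trans (hθ.2 _ (by simp) p2).symm
    simp [dir] at this
  obtain ⟨x0, r0, hx0⟩ := hex
  obtain ⟨⟨v, hv0, hv, hvθ⟩, -⟩ := hθ
  -- a period with positive second coordinate
  have hpos : ∃ p : ℤ, ∃ q : ℕ, 0 < q ∧ (∀ x r, c (x + p) (r + q) = c x r) ∧ dir (p, (q : ℤ)) = θ := by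
    rcases lt_trichotomy v.2 0 with h2 | h2 | h2
    · refine ⟨-v.1, (-v.2).toNat, by omega, ?_, ?_⟩
      · intro x r
        have := isPeriod_neg hv (x, r)
        rw [Int.toNat_of_nonneg (by omega)]
        simpa using this
      · rw [Int.toNat_of_nonneg (by omega), ← hvθ, ← dir_neg v]; rfl
    · exfalso
      -- a horizontal period
      obtain ⟨a, ha, hper⟩ : ∃ a : ℕ, 0 < a ∧ ∀ (n : ℕ) x r, c (x + n * a) r = c x r := by
        have hv1 : v.1 ≠ 0 := fun h1 => hv0 (Prod.ext h1 h2)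
        have hstep : ∀ x r, c (x + v.1.natAbs) r = c x r := by
          intro x r
          rcases le_or_gt 0 v.1 with h3 | h3
          · have := hv (x, r)
            simp only [Prod.fst_add, Prod.snd_add, h2, add_zero] at this
            rwa [Int.natAbs_of_nonneg h3]
          · have := isPeriod_neg hv (x, r)
            simp only [Prod.fst_add, Prod.snd_add, Prod.fst_neg, Prod.snd_neg, h2, neg_zero, add_zero] at this
            rwa [show ((v.1.natAbs : ℕ) : ℤ) = -v.1 by omega]
        refine ⟨v.1.natAbs, by omega, fun n => ?_⟩
        induction n with
        | zero => simp
        | succ n ih =>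
          intro x r
          rw [← ih x r, ← hstep (x + n * v.1.natAbs) r]
          congr 1; push_cast; ring
      have hrow : ∀ r, (c x0 r).IsC → ∀ x, (c x r).IsC := by
        intro r hr x
        -- sandwich
        have e1 : (c (x0 + (x - x0).natAbs * a) r).IsC := by rw [hper]; exact hr
        have e2 : (c (x0 - (x - x0).natAbs * a) r).IsC := by
          have := hper (x - x0).natAbs (x0 - (x - x0).natAbs * a) r
          rw [sub_add_cancel] at this
          rw [← this]; exact hr
        have e3 : ((x - x0).natAbs : ℤ) ≤ (x - x0).natAbs * a := by
          have : (1 : ℤ) ≤ a := by exact_mod_cast ha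
          nlinarith [Int.natCast_nonneg (x - x0).natAbs]
        exact strip_between h r (by omega) (by omega) e2 e1
      have hall : ∀ n : ℕ, ∀ x, (c x (r0 + n)).IsC := by
        intro n
        induction n with
        | zero => simpa using hrow r0 hx0
        | succ n ih =>
          push_cast; rw [← add_assoc]
          intro x
          have e1 : (c (x0 + dOf d (c x0 (r0 + n)) + (0 : ℕ)) (r0 + n + 1)).IsC :=
            strip_step h (r0 + n) x0 1 (fun i _ => ih _) (by omega) 0 (by omega)
          simp only [Nat.cast_zero, add_zero] at e1
          set y := x0 + dOf d (c x0 (r0 + n))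
          have f1 : (c (y + (x - y).natAbs * a) (r0 + n + 1)).IsC := by rw [hper]; exact e1
          have f2 : (c (y - (x - y).natAbs * a) (r0 + n + 1)).IsC := by
            have := hper (x - y).natAbs (y - (x - y).natAbs * a) (r0 + n + 1)
            rw [sub_add_cancel] at this
            rw [← this]; exact e1
          have e3 : ((x - y).natAbs : ℤ) ≤ (x - y).natAbs * a := by
            have : (1 : ℤ) ≤ a := by exact_mod_cast ha
            nlinarith [Int.natCast_nonneg (x - y).natAbs]
          exact strip_between h _ (by omega) (by omega) f2 f1
      let φ : ℕ → (Fin a → STile G K) := fun n i => c i (r0 + n)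
      obtain ⟨n1, n2, hne, heq⟩ := Finite.exists_ne_map_eq_of_infinite φ
      wlog hlt : n1 < n2 generalizing n1 n2
      · exact this n2 n1 hne.symm heq.symm (by omega)
      have hrep : ∀ x r, c x r = c (x % a) r := by
        intro x r
        have hd := Int.mul_ediv_add_emod x a
        rcases le_or_gt 0 (x / (a : ℤ)) with h3 | h3
        · have := hper (x / (a : ℤ)).toNat (x % a) r
          rw [Int.toNat_of_nonneg h3] at this
          rw [← this]; congr 1; linarith
        · have := hper (-(x / (a : ℤ))).toNat x r
          rw [Int.toNat_of_nonneg (by omega)] at this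
          rw [← this]; congr 1; linarith
      obtain ⟨B, hB⟩ := strip_bounded h M hM lam dig car hΦ (r0 + n1) 0 (n2 - n1) (by omega) (by
        intro x
        rw [add_zero, show r0 + n1 + ((n2 - n1 : ℕ) : ℤ) = r0 + n2 by omega, hrep x, hrep x]
        have hm0 := Int.emod_nonneg x (show (a : ℤ) ≠ 0 by omega)
        have hm1 := Int.emod_lt_of_pos x (show (0 : ℤ) < a by omega)
        have := congrFun heq ⟨(x % a).toNat, by omega⟩
        simp only [φ] at this
        rw [Int.toNat_of_nonneg hm0] at this
        exact this.symm)
      have := hB 0 (B + 1) (fun i _ => hall n1 _)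
      omega
    · refine ⟨v.1, v.2.toNat, by omega, ?_, ?_⟩
      · intro x r
        have := hv (x, r)
        rw [Int.toNat_of_nonneg (by omega)]
        simpa using this
      · rw [Int.toNat_of_nonneg (by omega), ← hvθ]
  obtain ⟨p, q, hq, hper, rfl⟩ := hpos
  obtain ⟨B, hB⟩ := strip_bounded h M hM lam dig car hΦ r0 p q hq (fun x => hper x r0)
  obtain ⟨l0, w, hw, hz⟩ := zone_exists hx0 B hB
  let l : ℕ → ℤ := fun j => Nat.rec l0 (fun j y => y + dOf d (c y (r0 + j))) j
  have l0' : l 0 = l0 := rfl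
  have lS : ∀ j, l (j + 1) = l j + dOf d (c (l j) (r0 + j)) := fun j => rfl
  have hZ : ∀ j : ℕ, Zone c (l j) (r0 + j) w := by
    intro j
    induction j with
    | zero => simpa [l0'] using hz
    | succ j ih =>
      have := zone_step h ih hw
      rw [lS]; push_cast; rwa [← add_assoc]
  have hex : ∀ j, ∃ g k, c (l j) (r0 + j) = C g k := by
    intro j
    have := (hZ j).1 0 hw
    rw [isC_iff] at this
    simpa using this
  choose g k00 hg using hex
  have hex : ∀ j i : ℕ, ∃ k, i < w → c (l j + i) (r0 + j) = C (g j) k := by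
    intro j i
    by_cases hi : i < w
    · obtain ⟨k, hk⟩ := strip_const h _ _ w (hZ j).1 _ _ (hg j) i hi
      exact ⟨k, fun _ => hk⟩
    · exact ⟨k00 0, fun h => absurd h hi⟩
  choose k hk using hex
  have hlS : ∀ j, l (j + 1) = l j + d (g j) := by
    intro j; rw [lS, hg]; rfl
  have hlq : ∀ j, l (j + q) = l j + p := by
    intro j
    have hz2 : Zone c (l j + p) (r0 + (j + q : ℕ)) w := by
      have := hZ j
      have e : r0 + ((j + q : ℕ) : ℤ) = r0 + j + q := by push_cast; ring
      rw [e]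
      refine ⟨fun i hi => ?_, ?_, ?_⟩
      · rw [show l j + p + i = l j + i + p by ring, hper]; exact this.1 i hi
      · rw [show l j + p - 1 = l j - 1 + p by ring, hper]; exact this.2.1
      · rw [show l j + p + w = l j + w + p by ring, hper]; exact this.2.2
    exact zone_unique h (hZ (j + q)) hz2 hw hw
  have hcell : ∀ j i : ℕ, i < w → C (g (j + q)) (k (j + q) i) = C (g j) (k j i) := by
    intro j i hi
    rw [← hk j i hi, ← hk (j + q) i hi, hlq, ← hper (l j + i)]
    congr 1
    · ring
    · push_cast; ring
  refine ⟨w, hw, g, k, q, hq, ?_, ?_, ?_, ?_⟩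
  · intro j i hi
    obtain ⟨g', k', h1, h2, h3, h4⟩ := (h _ _).hC3 _ _ (hk j i hi)
    have e1 : l j + i + d (g j) = l (j + 1) + i := by rw [hlS]; ring
    have e2 : r0 + j + 1 = r0 + (j + 1 : ℕ) := by push_cast; ring
    rw [e1, e2, hk (j + 1) i hi] at h1
    injection h1 with h5 h6
    subst h5 h6
    convert h4 using 1
    · split_ifs with h0
      · subst h0
        simp only [Nat.cast_zero, add_zero]
        exact ((kOf_eq_none _).2 (hZ j).2.1).symm
      · rw [show l j + i - 1 = l j + (i - 1 : ℕ) by omega, hk j (i - 1) (by omega)]; rfl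
    · split_ifs with h0
      · rw [show l j + i + 1 = l j + (i + 1 : ℕ) by omega, hk j (i + 1) (by omega)]; rfl
      · rw [show l j + i + 1 = l j + w by omega]
        exact ((kOf_eq_none _).2 (hZ j).2.2).symm
  · intro j
    have := hcell j 0 hw
    injection this
  · intro j i hi
    have := hcell j i hi
    injection this
  · congr 2
    have h1 : ∀ n, ∑ r ∈ Finset.range n, d (g r) = l n - l 0 := by
      intro n
      rw [← Finset.sum_range_sub]
      exact Finset.sum_congr rfl (fun i _ => by rw [hlS]; ring)
    have := hlq 0
    rw [zero_add] at this
    rw [h1, this]; ring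

end Sound2


open STile

section Complete

variable {G K : Type} {d : G → ℤ} {Φ : G → G → Option K → K → Option K → K → Prop}

theorem strip_complete_aux (w : ℕ) (hw : 0 < w) (hd : ∀ g, |d g| ≤ w) (g : ℕ → G) (k : ℕ → ℕ → K)
    (q : ℕ) (hq : 0 < q) (hrun : Run Φ w g k) (hg : ∀ r, g (r + q) = g r)
    (hk : ∀ r i, i < w → k (r + q) i = k r i) :
    ∃ c : ℤ → ℤ → STile G K, (∀ x r, StripCond d Φ c x r) ∧
      HasSlope (fun x : ℤ × ℤ => c x.1 x.2) (dir (∑ r ∈ Finset.range q, d (g r), (q : ℤ))) := by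
  set Δ := ∑ r ∈ Finset.range q, d (g r) with hΔ
  let ρ : ℤ → ℕ := fun r => (r % q).toNat
  let D : ℤ → ℤ := fun r => (r / q) * Δ + ∑ j ∈ Finset.range (ρ r), d (g j)
  have hq' : (0 : ℤ) < q := by exact_mod_cast hq
  have ρnn : ∀ r : ℤ, ((ρ r : ℕ) : ℤ) = r % q := fun r =>
    Int.toNat_of_nonneg (Int.emod_nonneg r hq'.ne')
  have ρlt : ∀ r : ℤ, ρ r < q := fun r => by
    have := Int.emod_lt_of_pos r hq'
    have := ρnn r
    omega
  have stepcase : ∀ r : ℤ, (ρ (r + 1) = ρ r + 1 ∧ (r + 1) / q = r / q) ∨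
      (ρ r + 1 = q ∧ ρ (r + 1) = 0 ∧ (r + 1) / q = r / q + 1) := by
    intro r
    have h1 := Int.mul_ediv_add_emod r q
    rw [← ρnn] at h1
    have h2 := ρlt r
    by_cases h : ρ r + 1 < q
    · left
      have h3 : (r + 1) / q = r / q ∧ (r + 1) % q = ρ r + 1 := by
        rw [Int.ediv_emod_unique hq']
        refine ⟨by linarith, by omega, by omega⟩
      refine ⟨?_, h3.1⟩
      have := ρnn (r + 1)
      omega
    · right
      have h4 : ρ r + 1 = q := by omega
      have h5 : (ρ r : ℤ) + 1 = q := by exact_mod_cast h4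
      have h3 : (r + 1) / q = r / q + 1 ∧ (r + 1) % q = 0 := by
        rw [Int.ediv_emod_unique hq']
        refine ⟨by linarith, by omega, by omega⟩
      refine ⟨h4, ?_, h3.1⟩
      have := ρnn (r + 1)
      omega
  have Dstep : ∀ r, D (r + 1) = D r + d (g (ρ r)) := by
    intro r
    simp only [D]
    rcases stepcase r with ⟨h1, h2⟩ | ⟨h1, h2, h3⟩
    · rw [h1, h2, Finset.sum_range_succ]; ring
    · rw [h2, h3]
      have := Finset.sum_range_succ (fun j => d (g j)) (ρ r)
      rw [h1] at this
      rw [hΔ, this]; simp; ring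
  have gstep : ∀ r, g (ρ (r + 1)) = g (ρ r + 1) := by
    intro r
    rcases stepcase r with ⟨h1, h2⟩ | ⟨h1, h2, h3⟩
    · rw [h1]
    · rw [h2, h1, ← hg 0, zero_add]
  have kstep : ∀ r i, i < w → k (ρ (r + 1)) i = k (ρ r + 1) i := by
    intro r i hi
    rcases stepcase r with ⟨h1, h2⟩ | ⟨h1, h2, h3⟩
    · rw [h1]
    · rw [h2, h1, ← hk 0 i hi, zero_add]
  have ρper : ∀ r m : ℤ, ρ (r + q * m) = ρ r := by
    intro r m; simp [ρ]
  have Dper : ∀ r m : ℤ, D (r + q * m) = D r + m * Δ := by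
    intro r m
    simp only [D, ρper]
    rw [Int.add_mul_ediv_left _ _ hq'.ne']; ring
  let c : ℤ → ℤ → STile G K := fun x r =>
    if x - D r < 0 then L else if x - D r < w then C (g (ρ r)) (k (ρ r) (x - D r).toNat) else R
  have cL : ∀ x r, c x r = L ↔ x < D r := by
    intro x r
    simp only [c]
    split_ifs with h1 h2 <;> simp <;> omega
  have cR : ∀ x r, c x r = R ↔ D r + w ≤ x := by
    intro x r
    simp only [c]
    split_ifs with h1 h2 <;> simp <;> omega
  have cC : ∀ (r : ℤ) (i : ℕ), i < w → c (D r + i) r = C (g (ρ r)) (k (ρ r) i) := by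
    intro r i hi
    simp only [c]
    rw [if_neg (by omega), if_pos (by omega)]
    simp
  have cIs : ∀ x r, (c x r).IsC ↔ D r ≤ x ∧ x < D r + w := by
    intro x r
    simp only [c]
    split_ifs with h1 h2 <;> simp [IsC, rank] <;> omega
  have cEx : ∀ x r g' k', c x r = C g' k' → ∃ i : ℕ, i < w ∧ x = D r + i ∧ g' = g (ρ r) ∧
      k' = k (ρ r) i := by
    intro x r g' k' h
    have h1 := (cIs x r).1 ((isC_iff _).2 ⟨_, _, h⟩)
    refine ⟨(x - D r).toNat, by omega, by omega, ?_⟩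
    have := cC r (x - D r).toNat (by omega)
    rw [show D r + ((x - D r).toNat : ℤ) = x by omega, h] at this
    injection this with h2 h3
    exact ⟨h2, h3⟩
  refine ⟨c, ?_, ?_⟩
  · intro x r
    have hds := Dstep r
    have hdb := abs_le.1 (hd (g (ρ r)))
    constructor
    · rw [cL, Ne, cR]; omega
    · rw [cL, Ne, cR]; omega
    · rw [cR, cR]; omega
    · rw [cR, Ne, cL]; omega
    · rw [cIs, Ne, cL]; omega
    · intro g1 k1 g2 k2 h1 h2
      obtain ⟨_, _, _, e1, _⟩ := cEx _ _ _ _ h1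
      obtain ⟨_, _, _, e2, _⟩ := cEx _ _ _ _ h2
      rw [e1, e2]
    · intro g1 k1 h1
      obtain ⟨i, hi, rfl, rfl, rfl⟩ := cEx _ _ _ _ h1
      refine ⟨g (ρ (r + 1)), k (ρ (r + 1)) i, ?_, ?_, ?_, ?_⟩
      · rw [← cC (r + 1) i hi]; congr 1; omega
      · rw [cIs, cIs]; omega
      · rw [cIs, cIs]; omega
      · have := hrun (ρ r) i hi
        rw [gstep, kstep r i hi]
        convert this using 1
        · split_ifs with h0
          · rw [kOf_eq_none, cIs]; omega
          · rw [show D r + (i : ℤ) - 1 = D r + (i - 1 : ℕ) by omega, cC r _ (by omega)]; rfl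
        · split_ifs with h0
          · rw [show D r + (i : ℤ) + 1 = D r + (i + 1 : ℕ) by omega, cC r _ (by omega)]; rfl
          · rw [kOf_eq_none, cIs]; omega
  · refine ⟨⟨(Δ, q), ?_, ?_, rfl⟩, ?_⟩
    · intro h
      have := congrArg Prod.snd h
      simp at this; omega
    · intro ⟨x, r⟩
      have h1 := Dper r 1
      have h2 := ρper r 1
      rw [mul_one] at h1 h2
      simp only [c, Prod.mk_add_mk, h1, h2]
      rw [show x + Δ - (D r + 1 * Δ) = x - D r by ring]
    · intro ⟨a, b⟩ hv0 hv
      have h1 : ∀ r, D (r + b) = D r + a := by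
        intro r
        have e : ∀ x, x + a < D (r + b) ↔ x < D r := by
          intro x
          rw [← cL, ← cL]
          have := hv (x, r)
          simp only [Prod.mk_add_mk] at this
          rw [this]
        have e1 := e (D r)
        have e2 := e (D r - 1)
        omega
      have h2 : ∀ n : ℕ, D (n * b) = D 0 + n * a := by
        intro n
        induction n with
        | zero => simp
        | succ n ih =>
          push_cast
          rw [add_mul, one_mul, h1, ih]; ring
      have h3 := Dper 0 b
      rw [zero_add, h2 q] at h3
      rw [dir_eq_iff _ _ hv0]
      · simp only; linarith
      · intro h
        have := congrArg Prod.snd h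
        simp at this; omega

end Complete

section Strip

variable {G K : Type}

/-- The rule extended with the Kari layer. -/
def kExt (Φ : G → G → Option K → K → Option K → K → Prop) (g g' : G × Bool)
    (a : Option (K × Fin 3 × Fin 4)) (k : K × Fin 3 × Fin 4) (b : Option (K × Fin 3 × Fin 4))
    (k' : K × Fin 3 × Fin 4) : Prop :=
  Φ g.1 g'.1 (a.map Prod.fst) k.1 (b.map Prod.fst) k'.1 ∧
    ∀ y, b = some y → kariRule g.2 k.2.1 k.2.2 y.2.2 k'.2.1

theorem strip_local {d : G → ℤ} {Φ : G → G → Option K → K → Option K → K → Prop} (M : ℕ)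
    (hM : ∀ g, |d g| ≤ M) :
    LocalPred (Finset.Icc (-M - 1, 0) (M + 1, 1) : Finset (ℤ × ℤ))
      (fun a : ℤ × ℤ → STile G K => StripCond d Φ (fun x r => a (x, r)) 0 0) := by
  intro a b hab h
  have e : ∀ x r : ℤ, -M - 1 ≤ x → x ≤ M + 1 → 0 ≤ r → r ≤ 1 → b (x, r) = a (x, r) := by
    intro x r h1 h2 h3 h4
    exact (hab (x, r) (by
      rw [Finset.mem_Icc]
      exact ⟨⟨h1, h3⟩, ⟨h2, h4⟩⟩)).symm
  have e00 := e 0 0 (by omega) (by omega) (by omega) (by omega)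
  have e10 := e (0 + 1) 0 (by omega) (by omega) (by omega) (by omega)
  have em0 := e (0 - 1) 0 (by omega) (by omega) (by omega) (by omega)
  have e01 := e 0 (0 + 1) (by omega) (by omega) (by omega) (by omega)
  obtain ⟨h1, h2, h3, h4, h5, h6, h7⟩ := h
  refine ⟨?_, ?_, ?_, ?_, ?_, ?_, ?_⟩
  · simpa only [e00, e10] using h1
  · simpa only [e00, e01] using h2
  · simpa only [e00, e10] using h3
  · simpa only [e00, e01] using h4
  · simpa only [e00, e10] using h5
  · simpa only [e00, e10] using h6
  · intro g k hgk
    have hb := abs_le.1 (hM g)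
    have f0 := e (0 + d g) (0 + 1) (by omega) (by omega) (by omega) (by omega)
    have f1 := e (0 + d g + 1) (0 + 1) (by omega) (by omega) (by omega) (by omega)
    have f2 := e (0 + d g - 1) (0 + 1) (by omega) (by omega) (by omega) (by omega)
    simp only [e00] at hgk
    have := h7 g k hgk
    simpa only [e00, e10, em0, f0, f1, f2] using this

theorem stripCond_shift {d : G → ℤ} {Φ : G → G → Option K → K → Option K → K → Prop}
    (c : ℤ → ℤ → STile G K) (u v : ℤ) :
    StripCond d Φ (fun x r => c (x + u) (r + v)) 0 0 ↔ StripCond d Φ c u v := by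
  have a1 : 0 + 1 + u = u + 1 := by ring
  have a2 : 0 + 1 + v = v + 1 := by ring
  have a3 : 0 - 1 + u = u - 1 := by ring
  have a4 : ∀ g, 0 + d g + u = u + d g := fun g => by ring
  have a5 : ∀ g, 0 + d g + 1 + u = u + d g + 1 := fun g => by ring
  have a6 : ∀ g, 0 + d g - 1 + u = u + d g - 1 := fun g => by ring
  constructor
  · rintro ⟨h1, h2, h3, h4, h5, h6, h7⟩
    simp only [zero_add u, zero_add v, a1, a2, a3, a4, a5, a6] at h1 h2 h3 h4 h5 h6 h7
    exact ⟨h1, h2, h3, h4, h5, h6, h7⟩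
  · rintro ⟨h1, h2, h3, h4, h5, h6, h7⟩
    constructor <;> simp only [zero_add u, zero_add v, a1, a2, a3, a4, a5, a6] <;> assumption

/-- The strip theorem: periodic runs of a row machine on finite zones give slope sets. -/
theorem strip_theorem [Finite G] [Finite K] (d : G → ℤ)
    (Φ : G → G → Option K → K → Option K → K → Prop) :
    ∃ S : Set (Option ℚ), IsSlopeSet S ∧
      (∀ θ ∈ S, ∃ w, 0 < w ∧ ∃ (g : ℕ → G) (k : ℕ → ℕ → K) (q : ℕ), 0 < q ∧ Run Φ w g k ∧
        (∀ r, g (r + q) = g r) ∧ (∀ r i, i < w → k (r + q) i = k r i) ∧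
        θ = dir (∑ r ∈ Finset.range q, d (g r), (q : ℤ))) ∧
      (∀ (w : ℕ) (g : ℕ → G) (k : ℕ → ℕ → K) (q : ℕ), 0 < w → (∀ g, |d g| ≤ w) → 0 < q →
        Run Φ w g k → (∀ r, g (r + q) = g r) → (∀ r i, i < w → k (r + q) i = k r i) →
        dir (∑ r ∈ Finset.range q, d (g r), (q : ℤ)) ∈ S) := by
  obtain ⟨M, hM⟩ : ∃ M : ℕ, ∀ g, |d g| ≤ M := by
    have hf := (Set.finite_range (fun g => (d g).natAbs)).bddAbove
    obtain ⟨M, hM⟩ := hf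
    refine ⟨M, fun g => ?_⟩
    have := hM ⟨g, rfl⟩
    simp only at this
    rw [Int.abs_eq_natAbs]
    exact_mod_cast this
  let d' : G × Bool → ℤ := fun g => d g.1
  have hM' : ∀ g, |d' g| ≤ M := fun g => hM g.1
  refine ⟨_, isSlopeSet_of_local _ _ (strip_local (d := d') (Φ := kExt Φ) M hM'), ?_, ?_⟩
  · rintro θ ⟨c, hc, hθ⟩
    have hc' : ∀ x r, StripCond d' (kExt Φ) (fun x r => c (x, r)) x r := by
      intro x r
      have := hc (x, r)
      rw [← stripCond_shift]
      exact this
    obtain ⟨w, hw, g, k, q, hq, h1, h2, h3, h4⟩ := strip_sound hc' M hM' Prod.snd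
      (fun k => k.2.1) (fun k => k.2.2) (fun g g' a k b k' h => h.2 _ rfl) θ hθ
    refine ⟨w, hw, fun r => (g r).1, fun r i => (k r i).1, q, hq, ?_, ?_, ?_, h4⟩
    · intro r i hi
      have := (h1 r i hi).1
      convert this using 1
      · split_ifs <;> rfl
      · split_ifs <;> rfl
    · intro r; simp only [h2]
    · intro r i hi; simp only [h3 r i hi]
  · intro w g k q hw hd hq hrun hg hk
    -- recurrence of the Kari rows
    let φ : ℕ → (Fin w → Fin 3 × Fin 4) := fun j i => (kDig (j * q) i, kCar (j * q) i)
    obtain ⟨n1, n2, hne, heq⟩ := Finite.exists_ne_map_eq_of_infinite φ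
    wlog hlt : n1 < n2 generalizing n1 n2
    · exact this n2 n1 hne.symm heq.symm (by omega)
    let Q := (n2 - n1) * q
    have hQ : 0 < Q := Nat.mul_pos (by omega) hq
    have hn2 : n2 * q = n1 * q + Q := by
      simp only [Q]; rw [← add_mul]; congr 1; omega
    let row : ℕ → ℕ := fun r => n1 * q + r % Q
    have hrow : ∀ r, row (r + 1) = row r + 1 ∨ (row (r + 1) = n1 * q ∧ row r + 1 = n2 * q) := by
      intro r
      simp only [row]
      have h1 := Nat.mod_lt r hQ
      by_cases h : r % Q + 1 < Q
      · left
        rw [Nat.add_mod, Nat.mod_eq_of_lt (show 1 < Q by omega), Nat.mod_eq_of_lt h]; rfl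
      · right
        have h2 : r % Q + 1 = Q := by omega
        constructor
        · have : (r + 1) % Q = 0 := by
            rw [← Nat.mod_add_mod, h2, Nat.mod_self]
          omega
        · omega
    have hdig : ∀ r i, i < w → kDig (row (r + 1)) i = kDig (row r + 1) i := by
      intro r i hi
      rcases hrow r with h | ⟨h1, h2⟩
      · rw [h]
      · rw [h1, h2]
        exact congrArg Prod.fst (congrFun heq ⟨i, hi⟩)
    have hper : ∀ r, row (r + Q) = row r := fun r => by simp [row]
    have hgm : ∀ n r, g (r + n * q) = g r := by
      intro n
      induction n with
      | zero => simp
      | succ n ih => intro r; rw [add_mul, one_mul, ← add_assoc, hg, ih]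
    have hkm : ∀ n r i, i < w → k (r + n * q) i = k r i := by
      intro n
      induction n with
      | zero => simp
      | succ n ih => intro r i hi; rw [add_mul, one_mul, ← add_assoc, hk _ _ hi, ih _ _ hi]
    obtain ⟨c, hc, hs⟩ := strip_complete_aux (d := d') (Φ := kExt Φ) w hw (fun g => hd g.1)
      (fun r => (g r, kLam (row r))) (fun r i => (k r i, kDig (row r) i, kCar (row r) i)) Q hQ
      (by
        intro r i hi
        refine ⟨?_, ?_⟩
        · have := hrun r i hi
          convert this using 1
          · split_ifs <;> rfl
          · split_ifs <;> rfl
        · intro y hy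
          split_ifs at hy with h
          simp only [Option.some.injEq] at hy
          subst hy
          simp only [hdig r i hi]
          exact kari_ok (row r) i)
      (by intro r; simp only [hper, Q, hgm])
      (by intro r i hi; simp only [hper]; simp only [Q, hkm _ _ _ hi])
    have hsum : ∀ n, ∑ r ∈ Finset.range (n * q), d (g r) = n * ∑ r ∈ Finset.range q, d (g r) := by
      intro n
      induction n with
      | zero => simp
      | succ n ih =>
        rw [add_mul, one_mul, Finset.sum_range_add, ih]
        have : ∑ x ∈ Finset.range q, d (g (n * q + x)) = ∑ x ∈ Finset.range q, d (g x) :=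
          Finset.sum_congr rfl (fun x _ => by rw [add_comm, hgm])
        rw [this]; push_cast; ring
    refine ⟨fun x => c x.1 x.2, ?_, ?_⟩
    · intro u
      have := (stripCond_shift c u.1 u.2).2 (hc u.1 u.2)
      exact this
    · convert hs using 1
      rw [dir_eq_iff]
      · simp only [d']
        rw [show Q = (n2 - n1) * q from rfl, hsum]
        push_cast; ring
      · intro h
        have := congrArg Prod.snd h
        simp at this; omega
      · intro h
        have := congrArg Prod.snd h
        simp at this; omega

end Strip


/-! ### Part 4: stack machines -/

open Turing Turing.PartrecToTM2

inductive StOp : Type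
  | keep : StOp
  | push (a : Γ') : StOp
  | pop : StOp

def StOp.app : StOp → List Γ' → List Γ'
  | .keep, l => l
  | .push a, l => a :: l
  | .pop, l => l.tail

/-- A multi-stack machine with state set `Q`. -/
structure StackM (Q : Type) where
  δ : Q → (K' → Option Γ') → Q × (K' → StOp)
  halt : Q → Prop
  idle : ∀ q t, halt q → δ q t = (q, fun _ => .keep)

def StackM.step {Q : Type} (m : StackM Q) (x : Q × (K' → List Γ')) : Q × (K' → List Γ') :=
  ((m.δ x.1 (fun k => (x.2 k).head?)).1,
    fun k => ((m.δ x.1 (fun k => (x.2 k).head?)).2 k).app (x.2 k))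

abbrev PStmt : Type := TM2.Stmt (fun _ : K' => Γ') Λ' (Option Γ')

abbrev PCfg : Type := TM2.Cfg (fun _ : K' => Γ') Λ' (Option Γ')

noncomputable section

def ptr : Λ' → PStmt := tr

/-- small-step transition on statements -/
def ssδ (x : PStmt × Option Γ') (t : K' → Option Γ') : (PStmt × Option Γ') × (K' → StOp) :=
  match x with
  | (.push k f q, v) => ((q, v), Function.update (fun _ => StOp.keep) k (.push (f v)))
  | (.peek k f q, v) => ((q, f v (t k)), fun _ => StOp.keep)
  | (.pop k f q, v) => ((q, f v (t k)), Function.update (fun _ => StOp.keep) k .pop)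
  | (.load a q, v) => ((q, a v), fun _ => StOp.keep)
  | (.branch p q₁ q₂, v) => ((cond (p v) q₁ q₂, v), fun _ => StOp.keep)
  | (.goto l, v) => ((ptr (l v), v), fun _ => StOp.keep)
  | (.halt, v) => ((.halt, v), fun _ => StOp.keep)

def ssM : StackM (PStmt × Option Γ') where
  δ := ssδ
  halt x := x.1 = .halt
  idle := by
    rintro ⟨q, v⟩ t h
    simp only at h
    subst h
    rfl

theorem app_update (k : K') (S : K' → List Γ') (o : StOp) :
    (fun k' => (Function.update (fun _ => StOp.keep) k o k').app (S k'))
      = Function.update S k (o.app (S k)) := by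
  ext1 k'
  by_cases h : k' = k
  · subst h; simp
  · simp [h, StOp.app]

theorem ss_push (k f q v S) : ssM.step ((.push k f q, v), S)
    = ((q, v), Function.update S k (f v :: S k)) := by
  have := app_update k S (.push (f v))
  exact Prod.ext rfl this

theorem ss_pop (k f q v S) : ssM.step ((.pop k f q, v), S)
    = ((q, f v (S k).head?), Function.update S k (S k).tail) := by
  have := app_update k S .pop
  exact Prod.ext rfl this

theorem ss_of_eval (cfg b : PCfg) (hb : b ∈ StateTransition.eval (TM2.step ptr) cfg) :
    ∀ (s : PStmt) v S, TM2.stepAux s v S = cfg → ∃ t, ssM.halt ((ssM.step^[t] ((s, v), S)).1) := by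
  refine StateTransition.evalInduction hb (C := fun cfg => ∀ (s : PStmt) v S,
    TM2.stepAux s v S = cfg → ∃ t, ssM.halt ((ssM.step^[t] ((s, v), S)).1)) ?_
  intro a _ IH s
  induction s with
  | push k f q ih =>
    intro v S h
    obtain ⟨t, ht⟩ := ih _ _ h
    refine ⟨t + 1, ?_⟩
    rwa [Function.iterate_succ_apply, ss_push]
  | peek k f q ih =>
    intro v S h
    obtain ⟨t, ht⟩ := ih _ _ h
    refine ⟨t + 1, ?_⟩
    rw [Function.iterate_succ_apply]
    simpa [StackM.step, ssM, ssδ, StOp.app] using ht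
  | pop k f q ih =>
    intro v S h
    obtain ⟨t, ht⟩ := ih _ _ h
    refine ⟨t + 1, ?_⟩
    rwa [Function.iterate_succ_apply, ss_pop]
  | load f q ih =>
    intro v S h
    obtain ⟨t, ht⟩ := ih _ _ h
    refine ⟨t + 1, ?_⟩
    rw [Function.iterate_succ_apply]
    simpa [StackM.step, ssM, ssδ, StOp.app] using ht
  | branch p q₁ q₂ ih₁ ih₂ =>
    intro v S h
    have : ∃ t, ssM.halt ((ssM.step^[t] ((cond (p v) q₁ q₂, v), S)).1) := by
      rw [TM2.stepAux] at h
      cases hp : p v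
      · rw [hp] at h; exact ih₂ _ _ h
      · rw [hp] at h; exact ih₁ _ _ h
    obtain ⟨t, ht⟩ := this
    refine ⟨t + 1, ?_⟩
    rw [Function.iterate_succ_apply]
    simpa [StackM.step, ssM, ssδ, StOp.app] using ht
  | goto l =>
    intro v S h
    rw [TM2.stepAux] at h
    subst h
    obtain ⟨t, ht⟩ := IH _ rfl (ptr (l v)) v S rfl
    refine ⟨t + 1, ?_⟩
    rw [Function.iterate_succ_apply]
    simpa [StackM.step, ssM, ssδ, StOp.app] using ht
  | halt =>
    intro v S h
    exact ⟨0, rfl⟩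

theorem eval_of_ss (t : ℕ) : ∀ (s : PStmt) v S, ssM.halt ((ssM.step^[t] ((s, v), S)).1) →
    (StateTransition.eval (TM2.step ptr) (TM2.stepAux s v S)).Dom := by
  have hhalt : ∀ v S, (StateTransition.eval (TM2.step ptr)
      (TM2.stepAux (TM2.Stmt.halt : PStmt) v S)).Dom := by
    intro v S
    rw [Part.dom_iff_mem]
    exact ⟨_, StateTransition.mem_eval.2 ⟨Relation.ReflTransGen.refl, rfl⟩⟩
  induction t with
  | zero =>
    intro s v S h
    have : s = .halt := h
    subst this
    exact hhalt v S
  | succ t ih =>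
    intro s v S h
    rw [Function.iterate_succ_apply] at h
    cases s with
    | push k f q =>
      rw [TM2.stepAux]
      apply ih
      rwa [ss_push] at h
    | peek k f q =>
      rw [TM2.stepAux]
      apply ih
      simpa [StackM.step, ssM, ssδ, app_update, StOp.app] using h
    | pop k f q =>
      rw [TM2.stepAux]
      apply ih
      rwa [ss_pop] at h
    | load f q =>
      rw [TM2.stepAux]
      apply ih
      simpa [StackM.step, ssM, ssδ, app_update, StOp.app] using h
    | branch p q₁ q₂ =>
      have h' : ssM.halt ((ssM.step^[t] ((cond (p v) q₁ q₂, v), S)).1) := by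
        simpa [StackM.step, ssM, ssδ, app_update, StOp.app] using h
      have := ih _ _ _ h'
      rw [TM2.stepAux]
      cases hp : p v <;> simpa [hp] using this
    | goto l =>
      rw [TM2.stepAux]
      have h' : ssM.halt ((ssM.step^[t] ((ptr (l v), v), S)).1) := by
        simpa [StackM.step, ssM, ssδ, app_update, StOp.app] using h
      have h4 : StateTransition.eval (TM2.step ptr) (⟨some (l v), v, S⟩ : PCfg) =
          StateTransition.eval (TM2.step ptr) (TM2.stepAux (ptr (l v)) v S) :=
        StateTransition.reaches_eval (Relation.ReflTransGen.single rfl)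
      rw [h4]
      exact ih _ _ _ h'
    | halt => exact hhalt v S

/-- initial stacks -/
def initS (n : ℕ) : K' → List Γ' := K'.elim (trList [n]) [] [] []

theorem StackM.step_restrict {Q : Type} (m : StackM Q) (A : Set Q)
    (hA : ∀ q ∈ A, ∀ t, (m.δ q t).1 ∈ A) : ∃ m' : StackM A, ∀ q : A, (∀ t, ((m'.δ q t).1 : Q) = (m.δ q t).1)
      ∧ (∀ t, (m'.δ q t).2 = (m.δ q t).2) ∧ (m'.halt q ↔ m.halt q) := by
  refine ⟨⟨fun q t => (⟨(m.δ q t).1, hA q q.2 t⟩, (m.δ q t).2), fun q => m.halt q, ?_⟩, ?_⟩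
  · intro q t h
    ext1
    · exact Subtype.ext (by simp [m.idle q t h])
    · simp [m.idle q t h]
  · intro q
    exact ⟨fun t => rfl, fun t => rfl, Iff.rfl⟩

theorem exists_stackM (F : ℕ →. ℕ) (hF : Partrec F) :
    ∃ (Q : Type) (_ : Finite Q) (m : StackM Q) (q0 : Q), ∀ n,
      (F n).Dom ↔ ∃ t, m.halt ((m.step^[t] (q0, initS n)).1) := by
  classical
  have h1 : Nat.Partrec' (fun v : List.Vector ℕ 1 => F v.head) := by
    rw [Nat.Partrec'.part_iff₁]; exact hF
  obtain ⟨c, hc⟩ := ToPartrec.Code.exists_code h1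
  have hc' : ∀ n, (F n).Dom ↔ (c.eval [n]).Dom := by
    intro n
    have := hc ⟨[n], rfl⟩
    simp only at this
    rw [this]
    rfl
  have hev : ∀ n, (F n).Dom ↔ ∃ t, ssM.halt ((ssM.step^[t] ((ptr (trNormal c Cont'.halt), none), initS n)).1) := by
    intro n
    rw [hc']
    have h2 : StateTransition.eval (TM2.step ptr) (init c [n] : PCfg) = halt <$> ToPartrec.Code.eval c [n] := tr_eval c [n]
    have h3 : (StateTransition.eval (TM2.step ptr) (init c [n] : PCfg)).Dom ↔ (c.eval [n]).Dom := by
      rw [h2]; rfl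
    rw [← h3]
    have h4 : StateTransition.eval (TM2.step ptr) (init c [n] : PCfg) =
        StateTransition.eval (TM2.step ptr) (TM2.stepAux (ptr (trNormal c Cont'.halt)) none (initS n)) :=
      StateTransition.reaches_eval (Relation.ReflTransGen.single rfl)
    rw [h4]
    constructor
    · intro h
      obtain ⟨b, hb⟩ := Part.dom_iff_mem.1 h
      exact ss_of_eval _ b hb _ _ _ rfl
    · rintro ⟨t, ht⟩
      exact eval_of_ss t _ _ _ ht
  let Sf := codeSupp c Cont'.halt
  let _ : Inhabited Λ' := ⟨trNormal c Cont'.halt⟩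
  have hsup : TM2.Supports ptr Sf := tr_supports c Cont'.halt
  let A : Set (PStmt × Option Γ') := {x | some x.1 ∈ TM2.stmts ptr Sf}
  have hfinΓ : Finite Γ' := inferInstance
  have hAfin : A.Finite := by
    have h5 : (Option.some ⁻¹' (TM2.stmts ptr Sf : Set (Option PStmt))).Finite :=
      Set.Finite.preimage (Option.some_injective _).injOn (Finset.finite_toSet _)
    have := h5.prod (Set.finite_univ : (Set.univ : Set (Option Γ')).Finite)
    exact this.subset (fun x hx => ⟨hx, trivial⟩)
  have htr : ∀ l ∈ Sf, some (ptr l) ∈ TM2.stmts ptr Sf := by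
    intro l hl
    rw [TM2.stmts, Finset.some_mem_insertNone, Finset.mem_biUnion]
    exact ⟨l, hl, TM2.stmts₁_self⟩
  have hAcl : ∀ q ∈ A, ∀ t, (ssM.δ q t).1 ∈ A := by
    rintro ⟨s, v⟩ hs t
    have hs' : some s ∈ TM2.stmts ptr Sf := hs
    cases s with
    | push k f q =>
      exact TM2.stmts_trans (by simp only [TM2.stmts₁, Finset.mem_insert]; exact Or.inr TM2.stmts₁_self) hs'
    | peek k f q =>
      exact TM2.stmts_trans (by simp only [TM2.stmts₁, Finset.mem_insert]; exact Or.inr TM2.stmts₁_self) hs'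
    | pop k f q =>
      exact TM2.stmts_trans (by simp only [TM2.stmts₁, Finset.mem_insert]; exact Or.inr TM2.stmts₁_self) hs'
    | load f q =>
      exact TM2.stmts_trans (by simp only [TM2.stmts₁, Finset.mem_insert]; exact Or.inr TM2.stmts₁_self) hs'
    | branch p q₁ q₂ =>
      have e : ∀ b : Bool, some (cond b q₁ q₂) ∈ TM2.stmts ptr Sf := by
        intro b
        refine TM2.stmts_trans ?_ hs'
        simp only [TM2.stmts₁, Finset.mem_insert, Finset.mem_union]
        cases b
        · exact Or.inr (Or.inr TM2.stmts₁_self)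
        · exact Or.inr (Or.inl TM2.stmts₁_self)
      exact e (p v)
    | goto l =>
      exact htr _ (TM2.stmts_supportsStmt hsup hs' v)
    | halt => exact hs'
  obtain ⟨m', hm'⟩ := ssM.step_restrict A hAcl
  have hq0 : (ptr (trNormal c Cont'.halt), none) ∈ A := htr _ hsup.1
  refine ⟨A, hAfin, m', ⟨_, hq0⟩, fun n => ?_⟩
  rw [hev]
  have hit : ∀ t (x : A × (K' → List Γ')), ((((m'.step^[t] x).1 : A) : PStmt × Option Γ'),
      (m'.step^[t] x).2) = ssM.step^[t] ((x.1 : PStmt × Option Γ'), x.2) := by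
    intro t
    induction t with
    | zero => intro x; rfl
    | succ t ih =>
      intro x
      rw [Function.iterate_succ_apply, Function.iterate_succ_apply, ih]
      congr 1
      simp only [StackM.step, (hm' x.1).1, (hm' x.1).2.1]
  apply exists_congr
  intro t
  have := hit t (⟨_, hq0⟩, initS n)
  simp only at this
  rw [← this, (hm' _).2.2]

end


/-! ### Part 5: the row machine -/

open Turing Turing.PartrecToTM2

structure RG (Q : Type) where
  q : Q
  tops : K' → Option Γ'
  reset : Bool
  wrap : Bool
  dl : Option Γ'

structure RK where
  word : Option Γ'
  stk : K' → Option Γ'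
  u : Bool
  s : Bool

instance : Finite K' := by
  apply Finite.of_injective (fun x : K' => (x = .main, x = .rev, x = .aux))
  rintro ⟨⟩ ⟨⟩ h <;> simp_all

instance {Q : Type} [Finite Q] : Finite (RG Q) := by
  apply Finite.of_injective
    (fun x : RG Q => (x.q, x.tops, x.reset, x.wrap, x.dl))
  rintro ⟨⟩ ⟨⟩ h
  simp at h
  simp [h]

instance : Finite RK := by
  apply Finite.of_injective (fun x : RK => (x.word, x.stk, x.u, x.s))
  rintro ⟨⟩ ⟨⟩ h
  simp at h
  simp [h]

/-- Drift letters. -/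
def drift : Option Γ' → ℤ
  | some .bit1 => 2
  | some _ => -2
  | none => 0

def IsBit (x : Γ') : Prop := x = .bit0 ∨ x = .bit1

structure RShape (a : Option RK) (k : RK) (b : Option RK) : Prop where
  hnone : k.word = none → ∀ y, b = some y → y.word = none
  hcons : k.word = some .cons → ∀ y, b = some y → y.word = none
  hcons' : k.word = some .cons → ∃ x, a = some x ∧ x.word = some .bit1
  hbit : ∀ x, k.word = some x → IsBit x → ∃ y, b = some y ∧ y.word ≠ none
  hl : k.word ≠ some .consₗ
  h0 : a = none → k.word ≠ none

def stkRule : StOp → Option (Option Γ') → Option Γ' → Option (Option Γ') → Option Γ' → Prop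
  | .keep, _, k, _, k' => k' = k
  | .push γ, a, k, b, k' => k' = a.getD (some γ) ∧ (b = none → k = none)
  | .pop, _, _, b, k' => k' = b.getD none

structure RRule {Q : Type} (m : StackM Q) (q0 : Q) (g g' : RG Q) (a : Option RK) (k : RK)
    (b : Option RK) (k' : RK) : Prop where
  static : k'.word = k.word
  shape : RShape a k b
  tops : a = none → g.tops = k.stk
  reset : g.reset = true → m.halt g.q ∧ g'.q = q0 ∧
    ∀ κ, k'.stk κ = if κ = K'.main then k.word else none
  next : g.reset = false → g'.q = (m.δ g.q g.tops).1 ∧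
    ∀ κ, stkRule ((m.δ g.q g.tops).2 κ) (a.map (fun x => x.stk κ)) (k.stk κ)
      (b.map (fun x => x.stk κ)) (k'.stk κ)
  u_last : b = none → k.u = false
  u_start : g.reset = false → a = none → k'.u = true
  u_move : g.reset = false → ∀ x, a = some x → x.u = true → k'.u = true
  s_move : ∀ x, a = some x → x.s = true → x.word ≠ some .cons → k'.s = true
  s_wrap : k.s = true → k.word = some .cons → g.wrap = true
  s_start : a = none → g.wrap = true → k'.s = true
  s_reset : a = none → g.reset = true → k'.s = true
  s_dl : k.s = true → g.dl = k.word

def Wd (p : PosNum) : List Γ' := trPosNum p ++ [.cons]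

theorem trList_posNum (p : PosNum) : trList [(p : ℕ)] = Wd p := by
  simp [trList, trNat, Wd, trNum]

theorem exists_posNum (l : List Γ') (hl : ∀ x ∈ l, IsBit x) : ∃ p, trPosNum p = l ++ [.bit1] := by
  induction l with
  | nil => exact ⟨.one, rfl⟩
  | cons x l ih =>
    obtain ⟨p, hp⟩ := ih (fun y hy => hl y (by simp [hy]))
    rcases hl x (by simp) with rfl | rfl
    · exact ⟨.bit0 p, by simp [trPosNum, hp]⟩
    · exact ⟨.bit1 p, by simp [trPosNum, hp]⟩

theorem word_list (w : ℕ) : ∀ (word : ℕ → Option Γ'), 0 < w → (∃ x, word 0 = some x ∧ IsBit x) →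
    (∀ i, word i = none → i + 1 < w → word (i + 1) = none) →
    (∀ i, word i = some .cons → i + 1 < w → word (i + 1) = none) →
    (∀ i x, i < w → word i = some x → IsBit x → i + 1 < w ∧ word (i + 1) ≠ none) →
    (∀ i, i + 1 < w → word (i + 1) = some .cons → word i = some .bit1) →
    (∀ i, i < w → word i ≠ some .consₗ) →
    ∃ p, (Wd p).length ≤ w ∧ ∀ i, i < w → word i = (Wd p)[i]? := by
  suffices H : ∀ (word : ℕ → Option Γ'), 0 < w → (∃ x, word 0 = some x ∧ IsBit x) →
    (∀ i, word i = none → i + 1 < w → word (i + 1) = none) →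
    (∀ i, word i = some .cons → i + 1 < w → word (i + 1) = none) →
    (∀ i x, i < w → word i = some x → IsBit x → i + 1 < w ∧ word (i + 1) ≠ none) →
    (∀ i, i + 1 < w → word (i + 1) = some .cons → word i = some .bit1) →
    (∀ i, i < w → word i ≠ some .consₗ) →
    ∃ l : List Γ', (∀ x ∈ l, IsBit x) ∧ (l ++ [Γ'.bit1, Γ'.cons]).length ≤ w ∧
      ∀ i, i < w → word i = (l ++ [Γ'.bit1, Γ'.cons])[i]? by
    intro word h0 h1 h2 h3 h4 h5 h6
    obtain ⟨l, hl, hlen, hw⟩ := H word h0 h1 h2 h3 h4 h5 h6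
    obtain ⟨p, hp⟩ := exists_posNum l hl
    refine ⟨p, ?_, ?_⟩
    · simpa [Wd, hp] using hlen
    · simpa [Wd, hp] using hw
  induction w with
  | zero => intro _ h; omega
  | succ w ih =>
    intro word _ ⟨x, hx, hxb⟩ h2 h3 h4 h5 h6
    obtain ⟨hw1, hne⟩ := h4 0 x (by omega) hx hxb
    rw [zero_add] at hne
    by_cases hc : word 1 = some .cons
    · refine ⟨[], by simp, by simp; omega, ?_⟩
      have hn : ∀ i, i + 2 < w + 1 → word (i + 2) = none := by
        intro i
        induction i with
        | zero => intro h; exact h3 1 hc h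
        | succ i ih => intro h; exact h2 (i + 2) (ih (by omega)) (by omega)
      intro i hi
      match i with
      | 0 => simpa using h5 0 hw1 hc
      | 1 => simpa using hc
      | i + 2 => simpa using hn i hi
    · obtain ⟨l, hl, hlen, hl2⟩ := ih (fun i => word (i + 1)) (by omega) (by
          cases h : word 1 with
          | none => exact absurd h hne
          | some y =>
            refine ⟨y, rfl, ?_⟩
            cases y with
            | consₗ => exact absurd h (h6 1 hw1)
            | cons => exact absurd h hc
            | bit0 => exact Or.inl rfl
            | bit1 => exact Or.inr rfl)
        (fun i h hi => h2 (i + 1) h (by omega)) (fun i h hi => h3 (i + 1) h (by omega))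
        (fun i x hi h hb => by
          have := h4 (i + 1) x (by omega) h hb
          exact ⟨by omega, this.2⟩)
        (fun i hi h => h5 (i + 1) (by omega) h) (fun i hi => h6 (i + 1) (by omega))
      refine ⟨x :: l, ?_, ?_, ?_⟩
      · intro y hy
        rcases List.mem_cons.1 hy with rfl | hy
        · exact hxb
        · exact hl y hy
      · simp at hlen ⊢; omega
      · intro i hi
        match i with
        | 0 => simpa using hx
        | i + 1 => simpa using hl2 i (by omega)

theorem stkRule_list (o : StOp) (S : List Γ') (w : ℕ) (hS : S.length ≤ w) (f : ℕ → Option Γ')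
    (hw : 0 < w)
    (h : ∀ i, i < w → stkRule o (if i = 0 then none else some (S[i - 1]?)) S[i]?
      (if i + 1 < w then some (S[i + 1]?) else none) (f i)) :
    (o.app S).length ≤ w ∧ ∀ i, i < w → f i = (o.app S)[i]? := by
  cases o with
  | keep => exact ⟨hS, h⟩
  | push γ =>
    constructor
    · have := (h (w - 1) (by omega)).2 (by rw [if_neg (by omega)])
      rw [List.getElem?_eq_none_iff] at this
      simp [StOp.app]; omega
    · intro i hi
      have := (h i hi).1
      rw [this]
      rcases i with _ | i <;> simp [StOp.app]
  | pop =>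
    constructor
    · simp [StOp.app]; omega
    · intro i hi
      have : f i = _ := h i hi
      rw [this]
      split_ifs with h1
      · simp [StOp.app]
      · simp [StOp.app]; omega

theorem stkRule_list' (o : StOp) (S : List Γ') (w : ℕ) (hS : S.length + 1 ≤ w) (i : ℕ) (hi : i < w) :
    stkRule o (if i = 0 then none else some (S[i - 1]?)) S[i]?
      (if i + 1 < w then some (S[i + 1]?) else none) ((o.app S)[i]?) := by
  cases o with
  | keep => rfl
  | push γ =>
    refine ⟨?_, ?_⟩
    · rcases i with _ | i <;> simp [StOp.app]
    · intro h
      split_ifs at h with h1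
      rw [List.getElem?_eq_none_iff]
      omega
  | pop =>
    simp only [stkRule]
    split_ifs with h1
    · simp [StOp.app]
    · simp [StOp.app]; omega

theorem app_length (o : StOp) (S : List Γ') : (o.app S).length ≤ S.length + 1 := by
  cases o <;> simp [StOp.app]; omega


open Turing Turing.PartrecToTM2

theorem trPosNum_bits (p : PosNum) : ∃ l, trPosNum p = l ++ [Γ'.bit1] ∧ ∀ x ∈ l, IsBit x := by
  induction p with
  | one => exact ⟨[], rfl, by simp⟩
  | bit1 p ih =>
    obtain ⟨l, h, hl⟩ := ih
    refine ⟨.bit1 :: l, by simp [trPosNum, h], ?_⟩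
    intro x hx
    rcases List.mem_cons.1 hx with rfl | hx
    · exact Or.inr rfl
    · exact hl x hx
  | bit0 p ih =>
    obtain ⟨l, h, hl⟩ := ih
    refine ⟨.bit0 :: l, by simp [trPosNum, h], ?_⟩
    intro x hx
    rcases List.mem_cons.1 hx with rfl | hx
    · exact Or.inl rfl
    · exact hl x hx

theorem Wd_facts (p : PosNum) : 2 ≤ (Wd p).length ∧
    (∀ i, i + 1 < (Wd p).length → ∃ x, (Wd p)[i]? = some x ∧ IsBit x) ∧
    (∀ i, i + 1 = (Wd p).length → (Wd p)[i]? = some .cons) ∧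
    (∀ i, i + 2 = (Wd p).length → (Wd p)[i]? = some .bit1) ∧
    (∀ i, (Wd p).length ≤ i → (Wd p)[i]? = none) := by
  obtain ⟨l, h, hl⟩ := trPosNum_bits p
  have hW : Wd p = l ++ [Γ'.bit1, Γ'.cons] := by simp [Wd, h]
  rw [hW]
  refine ⟨by simp, ?_, ?_, ?_, ?_⟩
  · intro i hi
    simp only [List.length_append, List.length_cons, List.length_nil] at hi
    by_cases h1 : i < l.length
    · exact ⟨l[i], by rw [List.getElem?_append_left h1]; simp [h1], hl _ (by simp)⟩
    · have : i = l.length := by omega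
      subst this
      exact ⟨.bit1, by simp, Or.inr rfl⟩
  · intro i hi
    simp only [List.length_append, List.length_cons, List.length_nil] at hi
    have : i = l.length + 1 := by omega
    subst this
    simp
  · intro i hi
    simp only [List.length_append, List.length_cons, List.length_nil] at hi
    have : i = l.length := by omega
    subst this
    simp
  · intro i hi
    simpa using hi

theorem IsBit.ne_cons {x : Γ'} (h : IsBit x) : x ≠ .cons := by
  rcases h with rfl | rfl <;> simp

theorem Wd_cons_iff (p : PosNum) (i : ℕ) : (Wd p)[i]? = some .cons ↔ i + 1 = (Wd p).length := by
  obtain ⟨h0, h1, h2, h3, h4⟩ := Wd_facts p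
  constructor
  · intro h
    rcases lt_trichotomy (i + 1) (Wd p).length with h' | h' | h'
    · obtain ⟨x, hx, hb⟩ := h1 i h'
      rw [h] at hx
      cases hx
      exact absurd rfl hb.ne_cons
    · exact h'
    · rw [h4 i (by omega)] at h
      cases h
  · exact h2 i

theorem Wd_isBit (p : PosNum) (i : ℕ) (x) (h : (Wd p)[i]? = some x) (hb : IsBit x) :
    i + 1 < (Wd p).length := by
  obtain ⟨h0, h1, h2, h3, h4⟩ := Wd_facts p
  rcases lt_trichotomy (i + 1) (Wd p).length with h' | h' | h'
  · exact h'
  · rw [h2 i h'] at h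
    cases h
    exact absurd rfl hb.ne_cons
  · rw [h4 i (by omega)] at h
    cases h

section Sound

variable {Q : Type} {m : StackM Q} {q0 : Q} {w : ℕ} {g : ℕ → RG Q} {k : ℕ → ℕ → RK}

theorem run_static (hR : Run (RRule m q0) w g k) (r i : ℕ) (hi : i < w) :
    (k r i).word = (k 0 i).word := by
  induction r with
  | zero => rfl
  | succ r ih => rw [(hR r i hi).static, ih]

theorem run_word (hw : 0 < w) (hR : Run (RRule m q0) w g k) :
    ∃ p, (Wd p).length ≤ w ∧ ∀ r i, i < w → (k r i).word = (Wd p)[i]? := by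
  have hS := fun i hi => (hR 0 i hi).shape
  suffices key : ∃ p, (Wd p).length ≤ w ∧ ∀ i, i < w → (k 0 i).word = (Wd p)[i]? by
    obtain ⟨p, h1, h2⟩ := key
    exact ⟨p, h1, fun r i hi => by rw [run_static hR r i hi, h2 i hi]⟩
  refine word_list w (fun i => (k 0 i).word) hw ?_ ?_ ?_ ?_ ?_ ?_
  · have h := hS 0 hw
    have hn := h.h0 (by simp)
    have hl := h.hl
    have hc := h.hcons'
    show ∃ x, (k 0 0).word = _ ∧ _
    cases h0 : (k 0 0).word with
    | none => exact absurd h0 hn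
    | some x =>
      refine ⟨x, rfl, ?_⟩
      cases x with
      | consₗ => exact absurd h0 hl
      | cons => simpa using hc h0
      | bit0 => exact Or.inl rfl
      | bit1 => exact Or.inr rfl
  · intro i h hi
    exact (hS i (by omega)).hnone h _ (by rw [if_pos hi])
  · intro i h hi
    exact (hS i (by omega)).hcons h _ (by rw [if_pos hi])
  · intro i x hi h hb
    obtain ⟨y, hy, hy'⟩ := (hS i hi).hbit x h hb
    split_ifs at hy with h1
    cases hy
    exact ⟨h1, hy'⟩
  · intro i hi h
    obtain ⟨x, hx, hx'⟩ := (hS (i + 1) hi).hcons' h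
    simp at hx
    subst hx
    exact hx'
  · intro i hi
    exact (hS i hi).hl

theorem reset_exists (hw : 0 < w) (hR : Run (RRule m q0) w g k) (r : ℕ) :
    ∃ r', (g (r + r')).reset = true := by
  by_contra! h
  have h' : ∀ r', (g (r + r')).reset = false := fun r' => by simpa using h r'
  have : ∀ i, i < w → (k (r + i + 1) i).u = true := by
    intro i
    induction i with
    | zero => intro hi; exact (hR (r + 0) 0 hi).u_start (h' 0) (by simp)
    | succ i ih =>
      intro hi
      exact (hR (r + (i + 1)) (i + 1) hi).u_move (h' _) _ (by simp; rfl) (ih (by omega))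
  have h1 := this (w - 1) (by omega)
  have h2 := (hR (r + (w - 1) + 1) (w - 1) (by omega)).u_last (by rw [if_neg (by omega)])
  rw [h1] at h2
  cases h2

theorem run_stacks (hw : 0 < w) (hR : Run (RRule m q0) w g k) (p : PosNum)
    (hp : (Wd p).length ≤ w) (hword : ∀ r i, i < w → (k r i).word = (Wd p)[i]?) (R : ℕ)
    (hreset : (g R).reset = true) (j : ℕ) (hj : ∀ j' < j, (g (R + 1 + j')).reset = false) :
    (g (R + 1 + j)).q = (m.step^[j] (q0, initS p)).1 ∧
    ∀ κ, ((m.step^[j] (q0, initS p)).2 κ).length ≤ w ∧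
      ∀ i, i < w → (k (R + 1 + j) i).stk κ = ((m.step^[j] (q0, initS p)).2 κ)[i]? := by
  induction j with
  | zero =>
    refine ⟨((hR R 0 hw).reset hreset).2.1, ?_⟩
    intro κ
    have hk : ∀ i, i < w → (k (R + 1) i).stk κ = if κ = K'.main then (Wd p)[i]? else none := by
      intro i hi
      rw [((hR R i hi).reset hreset).2.2 κ, hword R i hi]
    simp only [Function.iterate_zero, id_eq, initS, trList_posNum, Nat.add_zero]
    constructor
    · cases κ <;> simp [K'.elim, hp]
    · intro i hi
      rw [hk i hi]
      cases κ <;> simp [K'.elim]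
  | succ j ih =>
    obtain ⟨ih1, ih2⟩ := ih (fun j' hj' => hj j' (by omega))
    have hn := fun i hi => (hR (R + 1 + j) i hi).next (hj j (by omega))
    rw [Function.iterate_succ_apply']
    set X := m.step^[j] (q0, initS p) with hX
    have ht : (g (R + 1 + j)).tops = fun κ => (X.2 κ).head? := by
      rw [(hR (R + 1 + j) 0 hw).tops (by simp)]
      funext κ
      rw [(ih2 κ).2 0 hw]
      simp [List.head?_eq_getElem?]
    refine ⟨?_, ?_⟩
    · have := (hn 0 hw).1
      rw [ht, ih1] at this
      exact this
    · intro κ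
      have := stkRule_list ((m.δ X.1 (fun k => (X.2 k).head?)).2 κ) (X.2 κ) w (ih2 κ).1
        (fun i => (k (R + 1 + (j + 1)) i).stk κ) hw ?_
      · exact this
      · intro i hi
        have h := (hn i hi).2 κ
        rw [ht, ih1, (ih2 κ).2 i hi] at h
        convert h using 1
        · split_ifs with h0
          · rfl
          · simp [(ih2 κ).2 (i - 1) (by omega)]
        · split_ifs with h0
          · simp [(ih2 κ).2 (i + 1) h0]
          · rfl
        · rfl

theorem run_signal (hw : 0 < w) (hR : Run (RRule m q0) w g k) (p : PosNum)
    (hp : (Wd p).length ≤ w) (hword : ∀ r i, i < w → (k r i).word = (Wd p)[i]?) (R : ℕ)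
    (hreset : (g R).reset = true) (j : ℕ) :
    (k (R + 1 + j) (j % (Wd p).length)).s = true := by
  have hb := (Wd_facts p).1
  induction j with
  | zero => 
    rw [Nat.zero_mod]
    exact (hR R 0 hw).s_reset (by simp) hreset
  | succ j ih =>
    have hlt := Nat.mod_lt j (show 0 < (Wd p).length by omega)
    by_cases hc : j % (Wd p).length + 1 = (Wd p).length
    · have : (j + 1) % (Wd p).length = 0 := by
        rw [Nat.add_mod, Nat.mod_eq_of_lt (show 1 < (Wd p).length by omega), hc, Nat.mod_self]
      rw [this]
      have hwr := (hR (R + 1 + j) _ (by omega)).s_wrap ih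
        (by rw [hword _ _ (by omega), Wd_cons_iff, hc])
      exact (hR (R + 1 + j) 0 hw).s_start (by simp) hwr
    · have : (j + 1) % (Wd p).length = j % (Wd p).length + 1 := by
        rw [Nat.add_mod, Nat.mod_eq_of_lt (show 1 < (Wd p).length by omega), Nat.mod_eq_of_lt]
        omega
      rw [this]
      refine (hR (R + 1 + j) (j % (Wd p).length + 1) (by omega)).s_move _ (by simp) ih ?_
      rw [hword _ _ (by omega), ne_eq, Wd_cons_iff]
      exact hc

theorem run_dl (hw : 0 < w) (hR : Run (RRule m q0) w g k) (p : PosNum)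
    (hp : (Wd p).length ≤ w) (hword : ∀ r i, i < w → (k r i).word = (Wd p)[i]?) (R : ℕ)
    (hreset : (g R).reset = true) (j : ℕ) :
    (g (R + 1 + j)).dl = (Wd p)[j % (Wd p).length]? := by
  have hb := (Wd_facts p).1
  have hlt := Nat.mod_lt j (show 0 < (Wd p).length by omega)
  rw [(hR (R + 1 + j) (j % (Wd p).length) (by omega)).s_dl
    (run_signal hw hR p hp hword R hreset j), hword _ _ (by omega)]

end Sound

theorem sum_period_mul (f : ℕ → ℤ) (n : ℕ) (hf : ∀ r, f (r + n) = f r) (a : ℕ) :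
    ∑ r ∈ Finset.range (n * a), f r = a * ∑ r ∈ Finset.range n, f r := by
  induction a with
  | zero => simp
  | succ a ih =>
    rw [Nat.mul_succ, Finset.sum_range_add, ih]
    have : ∀ a x, f (n * a + x) = f x := by
      intro a
      induction a with
      | zero => simp
      | succ a ih =>
        intro x
        rw [← ih x, ← hf (n * a + x)]
        congr 1
        ring
    rw [Finset.sum_congr rfl (fun x _ => this a x)]
    push_cast
    ring

theorem sum_period_shift (f : ℕ → ℤ) (n : ℕ) (hf : ∀ r, f (r + n) = f r) (R : ℕ) :
    ∑ r ∈ Finset.range n, f (R + r) = ∑ r ∈ Finset.range n, f r := by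
  induction R with
  | zero => simp
  | succ R ih =>
    rw [← ih]
    have h1 := Finset.sum_range_succ' (fun r => f (R + r)) n
    have h2 := Finset.sum_range_succ (fun r => f (R + r)) n
    rw [h1] at h2
    have h3 := hf R
    simp only [Nat.add_zero] at h2
    have : ∀ r, f (R + 1 + r) = f (R + (r + 1)) := fun r => by congr 1; ring
    simp only [this]
    linarith

section Complete

variable {Q : Type} (m : StackM Q) (q0 : Q) (p : PosNum) (H : ℕ)

noncomputable def cG (j : ℕ) : RG Q where
  q := (m.step^[j] (q0, initS p)).1
  tops := fun κ => ((m.step^[j] (q0, initS p)).2 κ).head?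
  reset := decide (j + 1 = H)
  wrap := decide (j % (Wd p).length + 1 = (Wd p).length)
  dl := (Wd p)[j % (Wd p).length]?

noncomputable def cK (j i : ℕ) : RK where
  word := (Wd p)[i]?
  stk := fun κ => ((m.step^[j] (q0, initS p)).2 κ)[i]?
  u := decide (i < j)
  s := decide (i = j % (Wd p).length)

theorem cfg_length (j : ℕ) (κ : K') :
    ((m.step^[j] (q0, initS p)).2 κ).length ≤ (Wd p).length + j := by
  induction j generalizing κ with
  | zero =>
    simp only [Function.iterate_zero, id_eq, initS, trList_posNum, Nat.add_zero]
    cases κ <;> simp [K'.elim]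
  | succ j ih =>
    rw [Function.iterate_succ_apply']
    have := app_length ((m.δ (m.step^[j] (q0, initS p)).1
      (fun k => ((m.step^[j] (q0, initS p)).2 k).head?)).2 κ) ((m.step^[j] (q0, initS p)).2 κ)
    have h2 := ih κ
    simp only [StackM.step] at this ⊢
    omega

theorem halt_persist (T : ℕ) (hT : m.halt (m.step^[T] (q0, initS p)).1) (j : ℕ) (hj : T ≤ j) :
    m.halt (m.step^[j] (q0, initS p)).1 := by
  induction j, hj using Nat.le_induction with
  | base => exact hT
  | succ j _ ih =>
    rw [Function.iterate_succ_apply']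
    simp only [StackM.step]
    rw [m.idle _ _ ih]
    exact ih

theorem cShape (w i : ℕ) (hw : (Wd p).length < w) (hi : i < w) (j : ℕ) :
    RShape (if i = 0 then none else some (cK m q0 p j (i - 1))) (cK m q0 p j i)
      (if i + 1 < w then some (cK m q0 p j (i + 1)) else none) := by
  obtain ⟨f0, f1, f2, f3, f4⟩ := Wd_facts p
  constructor
  · intro h y hy
    split_ifs at hy
    cases hy
    simp only [cK] at h ⊢
    rw [List.getElem?_eq_none_iff] at h ⊢
    omega
  · intro h y hy
    split_ifs at hy
    cases hy
    simp only [cK] at h ⊢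
    rw [Wd_cons_iff] at h
    rw [List.getElem?_eq_none_iff]
    omega
  · intro h
    simp only [cK] at h ⊢
    rw [Wd_cons_iff] at h
    rw [if_neg (by omega)]
    exact ⟨_, rfl, f3 _ (by omega)⟩
  · intro x h hb
    simp only [cK] at h ⊢
    have := Wd_isBit p i x h hb
    rw [if_pos (by omega)]
    refine ⟨_, rfl, ?_⟩
    simp only [ne_eq, List.getElem?_eq_none_iff]
    omega
  · intro h
    simp only [cK] at h
    rcases lt_trichotomy (i + 1) (Wd p).length with h' | h' | h'
    · obtain ⟨x, hx, hb⟩ := f1 i h'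
      rw [hx] at h
      cases h
      rcases hb with h | h <;> cases h
    · rw [f2 i h'] at h
      cases h
    · rw [f4 i (by omega)] at h
      cases h
  · intro h
    split_ifs at h
    simp only [cK, ne_eq, List.getElem?_eq_none_iff]
    omega

theorem cRule (hH : ∃ a, 0 < a ∧ H = (Wd p).length * a)
    (hhalt : ∀ j, j + 1 = H → m.halt (m.step^[j] (q0, initS p)).1) (w i j j' : ℕ)
    (hw : (Wd p).length + H + 2 ≤ w) (hi : i < w) (hj : j < H)
    (hjj : (j + 1 = H ∧ j' = 0) ∨ (j + 1 < H ∧ j' = j + 1)) :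
    RRule m q0 (cG m q0 p H j) (cG m q0 p H j')
      (if i = 0 then none else some (cK m q0 p j (i - 1))) (cK m q0 p j i)
      (if i + 1 < w then some (cK m q0 p j (i + 1)) else none) (cK m q0 p j' i) := by
  have f0 := (Wd_facts p).1
  have hmod : ∀ x, x = j % (Wd p).length → x + 1 ≠ (Wd p).length →
      j' % (Wd p).length = x + 1 := by
    intro x hx hne
    have hlt := Nat.mod_lt j (show 0 < (Wd p).length by omega)
    have : (j + 1) % (Wd p).length = j % (Wd p).length + 1 := by
      rw [Nat.add_mod, Nat.mod_eq_of_lt (show 1 < (Wd p).length by omega), Nat.mod_eq_of_lt]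
      omega
    rcases hjj with ⟨h, rfl⟩ | ⟨h, rfl⟩
    · obtain ⟨a, ha, rfl⟩ := hH
      rw [h, Nat.mul_mod_right] at this
      omega
    · omega
  have hmod' : j % (Wd p).length + 1 = (Wd p).length → j' % (Wd p).length = 0 := by
    intro h
    rcases hjj with ⟨_, rfl⟩ | ⟨_, rfl⟩
    · simp
    · rw [Nat.add_mod, Nat.mod_eq_of_lt (show 1 < (Wd p).length by omega), h, Nat.mod_self]
  constructor
  · rfl
  · exact cShape m q0 p w i (by omega) hi j
  · intro h
    split_ifs at h with h0
    subst h0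
    simp [cG, cK, List.head?_eq_getElem?]
  · intro h
    simp only [cG, decide_eq_true_eq] at h
    rcases hjj with ⟨_, rfl⟩ | ⟨h', rfl⟩
    · refine ⟨hhalt j h, rfl, ?_⟩
      intro κ
      simp only [cK, Function.iterate_zero, id_eq, initS, trList_posNum]
      cases κ <;> simp [K'.elim]
    · omega
  · intro h
    simp only [cG, decide_eq_false_iff_not] at h
    rcases hjj with ⟨h', rfl⟩ | ⟨h', rfl⟩
    · omega
    · refine ⟨?_, ?_⟩
      · simp only [cG]
        rw [Function.iterate_succ_apply']
        rfl
      · intro κ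
        have := stkRule_list' ((m.δ (m.step^[j] (q0, initS p)).1
          (fun k => ((m.step^[j] (q0, initS p)).2 k).head?)).2 κ)
          ((m.step^[j] (q0, initS p)).2 κ) w (by
            have := cfg_length m q0 p j κ
            omega) i hi
        convert this using 1
        · rfl
        · split_ifs <;> simp [cK]
        · rfl
        · split_ifs <;> simp [cK]
        · simp only [cK]
          rw [Function.iterate_succ_apply']
          rfl
  · intro h
    split_ifs at h
    simp only [cK, decide_eq_false_iff_not]
    omega
  · intro h h1
    split_ifs at h1 with h0
    simp only [cG, decide_eq_false_iff_not] at h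
    simp only [cK, decide_eq_true_eq]
    omega
  · intro h x hx hu
    split_ifs at hx with h0
    cases hx
    simp only [cG, decide_eq_false_iff_not] at h
    simp only [cK, decide_eq_true_eq] at hu ⊢
    omega
  · intro x hx hs hc
    split_ifs at hx with h0
    cases hx
    simp only [cK, decide_eq_true_eq, ne_eq, Wd_cons_iff] at hs hc ⊢
    rw [hmod (i - 1) hs hc]
    omega
  · intro hs hc
    simp only [cK, cG, decide_eq_true_eq, Wd_cons_iff] at hs hc ⊢
    omega
  · intro h1 h
    split_ifs at h1 with h0
    simp only [cK, cG, decide_eq_true_eq] at h ⊢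
    rw [hmod' h, h0]
  · intro h1 h
    split_ifs at h1 with h0
    simp only [cK, cG, decide_eq_true_eq] at h ⊢
    rcases hjj with ⟨h', rfl⟩ | ⟨h', rfl⟩
    · simp [h0]
    · omega
  · intro hs
    simp only [cK, cG, decide_eq_true_eq] at hs ⊢
    rw [hs]

end Complete

def tW (p : PosNum) : ℤ := ∑ i ∈ Finset.range (Wd p).length, drift ((Wd p)[i]?)

theorem machine_slopes {Q : Type} [Finite Q] (m : StackM Q) (q0 : Q) :
    ∃ S, IsSlopeSet S ∧ ∀ θ, θ ∈ S ↔ ∃ p : PosNum,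
      (∃ t, m.halt ((m.step^[t] (q0, initS p)).1)) ∧ θ = dir (tW p, ((Wd p).length : ℤ)) := by
  obtain ⟨S, hS, h1, h2⟩ := strip_theorem (fun g : RG Q => drift g.dl) (RRule m q0)
  refine ⟨S, hS, fun θ => ⟨fun hθ => ?_, ?_⟩⟩
  · obtain ⟨w, hw, g, k, q, hq, hR, hg, hk, rfl⟩ := h1 θ hθ
    obtain ⟨p, hp, hword⟩ := run_word hw hR
    obtain ⟨R, hreset⟩ := reset_exists hw hR 0
    rw [zero_add] at hreset
    refine ⟨p, ?_, ?_⟩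
    · have hex := reset_exists hw hR (R + 1)
      classical
      refine ⟨Nat.find hex, ?_⟩
      have hf := Nat.find_spec hex
      have := run_stacks hw hR p hp hword R hreset (Nat.find hex)
        (fun j' hj' => by simpa using Nat.find_min hex hj')
      rw [← this.1]
      exact ((hR _ 0 hw).reset hf).1
    · have hb := (Wd_facts p).1
      set b := (Wd p).length with hbdef
      let e : ℕ → ℤ := fun j => drift (g j).dl
      let e' : ℕ → ℤ := fun j => e (R + 1 + j)
      have he : ∀ r, e (r + q) = e r := fun r => by simp only [e, hg]
      have he' : ∀ j, e' j = drift ((Wd p)[j % b]?) := by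
        intro j
        simp only [e', e, run_dl hw hR p hp hword R hreset j, hbdef]
      have s1 := sum_period_shift e q he (R + 1)
      have s2 := sum_period_mul e' q (fun r => by
        simp only [e', ← add_assoc, he]) b
      have s3 := sum_period_mul e' b (fun r => by simp only [he', Nat.add_mod_right]) q
      have s4 : ∑ r ∈ Finset.range b, e' r = tW p := by
        refine Finset.sum_congr rfl fun i hi => ?_
        rw [he', Nat.mod_eq_of_lt (Finset.mem_range.1 hi)]
      have s5 : ∑ r ∈ Finset.range q, e' r = ∑ r ∈ Finset.range q, e r := s1
      rw [mul_comm, s3, s4, s5] at s2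
      rw [dir_eq_iff _ _ (by simp; omega) (by simp; omega)]
      simp only
      show (∑ r ∈ Finset.range q, e r) * (b : ℤ) = tW p * (q : ℤ)
      linarith
  · rintro ⟨p, ⟨T, hT⟩, rfl⟩
    have hb := (Wd_facts p).1
    obtain ⟨b, hbdef⟩ : ∃ b, b = (Wd p).length := ⟨_, rfl⟩
    obtain ⟨H, hHdef⟩ : ∃ H, H = (Wd p).length * (T + 1) := ⟨_, rfl⟩
    have hTH : T < H := by rw [hHdef]; nlinarith
    have hmain := h2 ((Wd p).length + H + 2) (fun r => cG m q0 p H (r % H))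
      (fun r i => cK m q0 p (r % H) i) H (by omega) ?_ (by omega) ?_ (fun r => by simp)
      (fun r i _ => by simp)
    · convert hmain using 1
      rw [dir_eq_iff _ _ (by
        intro h0
        have h0 := congrArg Prod.snd h0
        simp only [Prod.snd_zero] at h0
        omega) (by
        have : H ≠ 0 := by omega
        simp [this])]
      simp only
      have s1 := sum_period_mul (fun j => drift ((Wd p)[j % (Wd p).length]?)) (Wd p).length
        (fun r => by simp only [Nat.add_mod_right]) (T + 1)
      have s2 : ∑ j ∈ Finset.range (Wd p).length, drift ((Wd p)[j % (Wd p).length]?) = tW p := by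
        refine Finset.sum_congr rfl fun i hi => ?_
        rw [Nat.mod_eq_of_lt (Finset.mem_range.1 hi)]
      have s3 : ∑ r ∈ Finset.range H, drift (cG m q0 p H (r % H)).dl =
          ∑ j ∈ Finset.range H, drift ((Wd p)[j % (Wd p).length]?) := by
        refine Finset.sum_congr rfl fun i hi => ?_
        rw [Nat.mod_eq_of_lt (Finset.mem_range.1 hi)]
        rfl
      rw [s3]
      rw [← hHdef, s2] at s1
      rw [s1, hHdef]
      push_cast
      ring
    · intro g
      have : ∀ x, |drift x| ≤ 2 := by
        rintro (_ | _ | _ | _ | _) <;> simp [drift]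
      refine (this _).trans ?_
      push_cast
      omega
    · intro r i hi
      have hlt := Nat.mod_lt r (show 0 < H by omega)
      refine cRule m q0 p H ⟨T + 1, by omega, hHdef⟩ (fun j hj => ?_) _ i (r % H) _ le_rfl hi hlt ?_
      · exact halt_persist m q0 p T hT j (by omega)
      · by_cases h : r % H + 1 = H
        · left
          refine ⟨h, ?_⟩
          rw [← Nat.mod_add_mod, h, Nat.mod_self]
        · right
          refine ⟨by omega, ?_⟩
          rw [← Nat.mod_add_mod, Nat.mod_eq_of_lt (by omega)]


open Turing Turing.PartrecToTM2

/-! ### Integers and primitive recursion -/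

theorem int_encode_ofNat (n : ℕ) : Encodable.encode (n : ℤ) = 2 * n := by
  rfl

theorem int_encode_negSucc (n : ℕ) : Encodable.encode (Int.negSucc n) = 2 * n + 1 := by
  rfl

theorem primrec_subNatNat : Primrec₂ (fun a b : ℕ => (a : ℤ) - b) := by
  refine Primrec.encode_iff.1 ?_
  have : Primrec (fun x : ℕ × ℕ => if x.2 ≤ x.1 then 2 * (x.1 - x.2) else 2 * (x.2 - x.1 - 1) + 1) := by
    refine Primrec.ite (Primrec.nat_le.comp Primrec.snd Primrec.fst) ?_ ?_
    · exact Primrec.nat_mul.comp (Primrec.const 2) (Primrec.nat_sub.comp Primrec.fst Primrec.snd)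
    · exact Primrec.succ.comp (Primrec.nat_mul.comp (Primrec.const 2) (Primrec.nat_sub.comp
        (Primrec.nat_sub.comp Primrec.snd Primrec.fst) (Primrec.const 1)))
  refine this.of_eq ?_
  rintro ⟨a, b⟩
  simp only
  split_ifs with h
  · rw [← Nat.cast_sub h, int_encode_ofNat]
  · have : (a : ℤ) - b = Int.negSucc (b - a - 1) := by omega
    rw [this, int_encode_negSucc]

theorem primrec_toNat : Primrec Int.toNat := by
  have : Primrec (fun z : ℤ => if Encodable.encode z % 2 = 0 then Encodable.encode z / 2 else 0) := by
    refine Primrec.ite (Primrec.eq.comp (Primrec.nat_mod.comp Primrec.encode (Primrec.const 2))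
      (Primrec.const 0)) ?_ (Primrec.const 0)
    exact Primrec.nat_div.comp Primrec.encode (Primrec.const 2)
  refine this.of_eq ?_
  rintro (n | n)
  · rw [Int.ofNat_eq_natCast, int_encode_ofNat]; simp
  · rw [int_encode_negSucc, if_neg (by omega)]; simp

theorem primrec_negToNat : Primrec (fun z : ℤ => (-z).toNat) := by
  have : Primrec (fun z : ℤ => if Encodable.encode z % 2 = 0 then 0 else Encodable.encode z / 2 + 1) := by
    refine Primrec.ite (Primrec.eq.comp (Primrec.nat_mod.comp Primrec.encode (Primrec.const 2))
      (Primrec.const 0)) (Primrec.const 0) ?_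
    exact Primrec.succ.comp (Primrec.nat_div.comp Primrec.encode (Primrec.const 2))
  refine this.of_eq ?_
  rintro (n | n)
  · rw [Int.ofNat_eq_natCast, int_encode_ofNat]; simp
  · rw [int_encode_negSucc, if_neg (by omega)]
    have : -Int.negSucc n = ((n + 1 : ℕ) : ℤ) := by simp
    rw [this, Int.toNat_natCast]
    omega

/-! ### Forward direction -/

def cstep (x : ℕ × ℕ × ℕ) : ℕ × ℕ × ℕ :=
  if x.1 = 0 then x else (x.1 / 2, x.2.1 + x.1 % 2, x.2.2 + 1)

theorem cstep_pos (n o l : ℕ) (h : n ≠ 0) : cstep (n, o, l) = (n / 2, o + n % 2, l + 1) :=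
  if_neg h

theorem primrec_cstep : Primrec cstep := by
  refine Primrec.ite (Primrec.eq.comp Primrec.fst (Primrec.const 0)) Primrec.id ?_
  refine Primrec.pair (Primrec.nat_div.comp Primrec.fst (Primrec.const 2)) (Primrec.pair ?_ ?_)
  · exact Primrec.nat_add.comp (Primrec.fst.comp Primrec.snd)
      (Primrec.nat_mod.comp Primrec.fst (Primrec.const 2))
  · exact Primrec.succ.comp (Primrec.snd.comp Primrec.snd)

def ones (p : PosNum) : ℕ := (trPosNum p).count .bit1

theorem cstep_iter (p : PosNum) : ∀ (o l n : ℕ), (trPosNum p).length ≤ n →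
    cstep^[n] ((p : ℕ), o, l) = (0, o + ones p, l + (trPosNum p).length) := by
  have h0 : ∀ n o l, cstep^[n] (0, o, l) = (0, o, l) := by
    intro n o l
    induction n with
    | zero => rfl
    | succ n ih => rw [Function.iterate_succ_apply', ih]; rfl
  induction p with
  | one =>
    intro o l n hn
    obtain ⟨n, rfl⟩ : ∃ k, n = k + 1 := ⟨n - 1, by simp [trPosNum] at hn; omega⟩
    rw [Function.iterate_succ_apply]
    simp [cstep, trPosNum, ones]
    exact h0 _ _ _
  | bit1 p ih =>
    intro o l n hn
    obtain ⟨n, rfl⟩ : ∃ k, n = k + 1 := ⟨n - 1, by simp [trPosNum] at hn; omega⟩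
    rw [Function.iterate_succ_apply]
    have : cstep ((p.bit1 : PosNum), o, l) = ((p : ℕ), o + 1, l + 1) := by
      rw [PosNum.cast_bit1, cstep_pos _ _ _ (by omega)]
      ext <;> simp <;> omega
    rw [this, ih _ _ _ (by simp [trPosNum] at hn; omega)]
    simp [trPosNum, ones]
    omega
  | bit0 p ih =>
    intro o l n hn
    obtain ⟨n, rfl⟩ : ∃ k, n = k + 1 := ⟨n - 1, by simp [trPosNum] at hn; omega⟩
    rw [Function.iterate_succ_apply]
    have hp := PosNum.cast_pos (α := ℕ) p
    have : cstep ((p.bit0 : PosNum), o, l) = ((p : ℕ), o, l + 1) := by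
      rw [PosNum.cast_bit0, cstep_pos _ _ _ (by omega)]
      ext <;> simp <;> omega
    rw [this, ih _ _ _ (by simp [trPosNum] at hn; omega)]
    simp [trPosNum, ones]
    omega

theorem size_le (p : PosNum) : (trPosNum p).length ≤ (p : ℕ) := by
  induction p with
  | one => simp [trPosNum]
  | bit1 p ih => simp [trPosNum, PosNum.cast_bit1]; omega
  | bit0 p ih =>
    have hp := PosNum.cast_pos (α := ℕ) p
    simp [trPosNum, PosNum.cast_bit0]; omega

theorem drift_sum (l : List Γ') :
    ∑ i ∈ Finset.range l.length, drift (l[i]?) = 4 * (l.count .bit1 : ℤ) - 2 * l.length := by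
  induction l with
  | nil => simp
  | cons x l ih =>
    rw [List.length_cons, Finset.sum_range_succ']
    simp only [List.getElem?_cons_succ, List.getElem?_cons_zero, ih]
    cases x <;> simp [drift] <;> ring

theorem tW_eq (p : PosNum) : tW p = 4 * (ones p : ℤ) - 2 * (Wd p).length := by
  rw [tW, drift_sum]
  simp [Wd, ones]

def decW (n : ℕ) : ℤ × ℤ :=
  let x := cstep^[n] (n, 0, 0)
  (((4 * x.2.1 : ℕ) : ℤ) - ((2 * (x.2.2 + 1) : ℕ) : ℤ), ((x.2.2 + 1 : ℕ) : ℤ) - (0 : ℕ))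

theorem decW_eq (p : PosNum) : decW (p : ℕ) = (tW p, ((Wd p).length : ℤ)) := by
  rw [decW, cstep_iter p 0 0 _ (size_le p), tW_eq]
  simp [Wd]

theorem primrec_decW : Primrec decW := by
  have h1 : Primrec (fun n : ℕ => cstep^[n] (n, 0, 0)) := by
    refine Primrec.nat_iterate Primrec.id (Primrec.pair Primrec.id (Primrec.const (0, 0))) ?_
    exact primrec_cstep.comp Primrec.snd
  have ho : Primrec (fun n : ℕ => (cstep^[n] (n, 0, 0)).2.1) :=
    Primrec.fst.comp (Primrec.snd.comp h1)
  have hl : Primrec (fun n : ℕ => (cstep^[n] (n, 0, 0)).2.2 + 1) :=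
    Primrec.succ.comp (Primrec.snd.comp (Primrec.snd.comp h1))
  refine Primrec.pair ?_ ?_
  · exact primrec_subNatNat.comp (Primrec.nat_mul.comp (Primrec.const 4) ho)
      (Primrec.nat_mul.comp (Primrec.const 2) hl)
  · exact primrec_subNatNat.comp hl (Primrec.const 0)

theorem cone_slopes (f : ℤ × ℤ →. Unit) (hf : Partrec f) : ∃ S, IsSlopeSet S ∧
    ∀ θ, θ ∈ S ↔ ∃ p : PosNum, (f (tW p, ((Wd p).length : ℤ))).Dom ∧
      θ = dir (tW p, ((Wd p).length : ℤ)) := by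
  have hF : Partrec (fun n : ℕ => (f (decW n)).map (fun _ => (0 : ℕ))) :=
    (hf.comp primrec_decW.to_comp).map ((Computable.const 0).comp Computable.snd).to₂
  obtain ⟨Q, hQ, m, q0, hm⟩ := exists_stackM _ hF
  obtain ⟨S, hS, h⟩ := machine_slopes m q0
  refine ⟨S, hS, fun θ => (h θ).trans ?_⟩
  refine exists_congr fun p => and_congr_left fun _ => ?_
  rw [← hm, decW_eq]
  simp

theorem exists_target (a b : ℤ) (hb : 0 < b) (h : |a| < 2 * b) :
    ∃ p : PosNum, dir (tW p, ((Wd p).length : ℤ)) = dir (a, b) := by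
  rw [abs_lt] at h
  obtain ⟨o, ho⟩ : ∃ o : ℕ, (o : ℤ) = 2 * b + a - 1 := ⟨(2 * b + a - 1).toNat, by omega⟩
  obtain ⟨z, hz⟩ : ∃ z : ℕ, (z : ℤ) = 2 * b - a - 1 := ⟨(2 * b - a - 1).toNat, by omega⟩
  obtain ⟨p, hp⟩ := exists_posNum (List.replicate z .bit0 ++ List.replicate o .bit1) (by
    intro x hx
    rcases List.mem_append.1 hx with h | h
    · exact Or.inl (List.eq_of_mem_replicate h)
    · exact Or.inr (List.eq_of_mem_replicate h))
  refine ⟨p, ?_⟩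
  have h1 : (ones p : ℤ) = o + 1 := by
    rw [ones, hp]
    simp [List.count_replicate]
  have h2 : ((Wd p).length : ℤ) = o + z + 2 := by
    rw [Wd, hp]
    simp
    ring
  rw [tW_eq, h1, h2, dir_eq_iff _ _ (by simp; omega) (by simp; omega)]
  simp only
  have e1 : (o : ℤ) + z + 2 = 4 * b := by omega
  have e2 : 4 * ((o : ℤ) + 1) - 2 * (o + z + 2) = 4 * a := by omega
  rw [e2, e1]
  ring

theorem isSlopeSet_of_re (S : Set (Option ℚ)) (f : ℤ × ℤ →. Unit) (hf : Partrec f)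
    (h : ∀ p : ℤ × ℤ, p ≠ 0 → ((f p).Dom ↔ dir p ∈ S)) : IsSlopeSet S := by
  obtain ⟨S1, hS1, h1⟩ := cone_slopes f hf
  have hsw : Computable (Prod.swap : ℤ × ℤ → ℤ × ℤ) :=
    Computable.pair Computable.snd Computable.fst
  obtain ⟨S2, hS2, h2⟩ := cone_slopes (fun v => f v.swap) (hf.comp hsw)
  have hne : ∀ p : PosNum, (tW p, ((Wd p).length : ℤ)) ≠ 0 := by
    intro p h0
    have h0 := congrArg Prod.snd h0
    have := (Wd_facts p).1
    simp only [Prod.snd_zero] at h0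
    omega
  have key : S = S1 ∪ {θ | swapDir θ ∈ S2} := by
    have cov : ∀ a b : ℤ, b ≠ 0 → |a| < 2 * |b| →
        ∃ p : PosNum, dir (tW p, ((Wd p).length : ℤ)) = dir (a, b) := by
      intro a b hb hab
      rcases lt_or_gt_of_ne hb with hb' | hb'
      · obtain ⟨p, hp⟩ := exists_target (-a) (-b) (by omega)
          (by rwa [abs_neg, ← abs_of_neg hb'])
        refine ⟨p, ?_⟩
        rw [hp, ← dir_neg (a, b)]
        rfl
      · exact exists_target a b hb' (by rwa [abs_of_pos hb'] at hab)
    ext θ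
    constructor
    · intro hθ
      obtain ⟨⟨a, b⟩, hv, rfl⟩ : ∃ v : ℤ × ℤ, v ≠ 0 ∧ dir v = θ := by
        cases θ with
        | none => exact ⟨(0, 1), by simp, by simp [dir]⟩
        | some x =>
          refine ⟨((x.den : ℤ), x.num), by simp, ?_⟩
          simp [dir, Rat.num_div_den]
      by_cases hc : |a| < 2 * |b|
      · have hb : b ≠ 0 := by
          rintro rfl
          have := abs_nonneg a
          simp at hc
          omega
        obtain ⟨p, hp⟩ := cov a b hb hc
        left
        rw [h1]
        exact ⟨p, (h _ (hne p)).2 (by rwa [hp]), hp.symm⟩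
      · have ha : a ≠ 0 := by
          rintro rfl
          apply hv
          have := abs_nonneg b
          have h0 : |b| = 0 := by
            simp at hc
            simp [hc]
          rw [abs_eq_zero] at h0
          rw [h0]; rfl
        obtain ⟨p, hp⟩ := cov b a ha (by
          have := abs_pos.2 ha
          omega)
        right
        show swapDir _ ∈ S2
        rw [h2]
        have hsd : dir (b, a) = swapDir (dir (a, b)) := dir_swap (a, b) hv
        refine ⟨p, ?_, ?_⟩
        · rw [h _ (by
            intro h0
            exact hne p (by rw [← Prod.swap_swap (tW p, _), h0]; rfl))]
          rw [dir_swap _ (hne p), hp, hsd, swapDir_swapDir]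
          exact hθ
        · rw [hp, hsd]
    · rintro (hθ | hθ)
      · obtain ⟨p, hd, rfl⟩ := (h1 _).1 hθ
        exact (h _ (hne p)).1 hd
      · obtain ⟨p, hd, he⟩ := (h2 _).1 hθ
        have := (h _ (by
            intro h0
            exact hne p (by rw [← Prod.swap_swap (tW p, _), h0]; rfl))).1 hd
        rw [dir_swap _ (hne p), ← he, swapDir_swapDir] at this
        exact this
  rw [key]
  exact hS1.union hS2.swap


/-! ### Backward direction: the slopes of a tiling system are recursively enumerable -/

theorem exists_quad {A : Type} [Finite A] (s : ℤ → A) (hs : ∀ P : ℤ, 0 < P → ∃ x, s (x + P) ≠ s x)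
    (L : ℕ) : ∃ i1 i2 j1 j2 : ℤ, i1 < i2 ∧ i2 ≤ j1 ∧ j1 < j2 ∧
      (∀ l : ℕ, l ≤ L → s (i1 + l) = s (i2 + l)) ∧ (∀ l : ℕ, l ≤ L → s (j1 + l) = s (j2 + l)) ∧
      ∃ x, i1 ≤ x ∧ x + (i2 - i1) < j2 ∧ s (x + (i2 - i1)) ≠ s x := by
  let t : ℤ → (Fin (L + 1) → A) := fun x l => s (x + (l : ℕ))
  have ht : ∀ x y, t x = t y → ∀ l : ℕ, l ≤ L → s (x + l) = s (y + l) := by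
    intro x y h l hl
    exact congrFun h ⟨l, by omega⟩
  have hright : ∀ M : ℤ, ∃ j1 j2 : ℤ, M ≤ j1 ∧ j1 < j2 ∧ t j1 = t j2 := by
    intro M
    obtain ⟨x, y, hne, he⟩ := Finite.exists_ne_map_eq_of_infinite (fun n : ℕ => t (M + n))
    rcases lt_or_gt_of_ne hne with h | h
    · exact ⟨M + x, M + y, by omega, by omega, he⟩
    · exact ⟨M + y, M + x, by omega, by omega, he.symm⟩
  obtain ⟨V, hV⟩ := Finite.exists_infinite_fiber (fun n : ℕ => t (-(n : ℤ)))
  have hV' := Set.infinite_coe_iff.1 hV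
  have hleft : ∀ M : ℕ, ∃ n : ℕ, M < n ∧ t (-(n : ℤ)) = V := by
    intro M
    obtain ⟨n, hn, hM⟩ := hV'.exists_gt M
    exact ⟨n, hM, hn⟩
  by_contra! h
  have hper : ∀ i1 i2 : ℤ, i1 < i2 → t i1 = t i2 → ∀ x, i1 ≤ x → s (x + (i2 - i1)) = s x := by
    intro i1 i2 hi he x hx
    obtain ⟨j1, j2, hj1, hj2, hj⟩ := hright (max i2 (x + (i2 - i1) + 1))
    have h1 := le_max_left i2 (x + (i2 - i1) + 1)
    have h2 := le_max_right i2 (x + (i2 - i1) + 1)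
    exact h i1 i2 j1 j2 hi (by omega) hj2 (ht _ _ he) (ht _ _ hj) x hx (by omega)
  obtain ⟨a0, -, ha0⟩ := hleft 0
  obtain ⟨a1, h01, ha1⟩ := hleft a0
  obtain ⟨x, hx⟩ := hs ((a1 : ℤ) - a0) (by omega)
  apply hx
  obtain ⟨a2, h12, ha2⟩ := hleft (a1 + x.natAbs)
  have p1 := hper (-a1) (-a0) (by omega) (by rw [ha0, ha1])
  have p2 := hper (-a2) (-a1) (by omega) (by rw [ha2, ha1])
  have e1 := p2 x (by omega)
  have e2 := p2 (x + ((a1 : ℤ) - a0)) (by omega)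
  have e3 := p1 (x + (-(a1 : ℤ) - -(a2 : ℤ))) (by omega)
  rw [← e1, ← e3, ← e2]
  congr 1
  ring

def foldZ (m k n : ℕ) (x : ℤ) : ℕ :=
  if x < 0 then (x % m).toNat else if x < k then m + x.toNat else m + k + ((x - k) % n).toNat

theorem foldZ_left (m k n : ℕ) (x : ℤ) (hx : x < 0) : foldZ m k n (x - m) = foldZ m k n x := by
  rw [foldZ, foldZ, if_pos hx, if_pos (by omega)]
  simp

theorem foldZ_right (m k n : ℕ) (x : ℤ) (hx : k ≤ x) : foldZ m k n (x + n) = foldZ m k n x := by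
  rw [foldZ, foldZ, if_neg (by omega), if_neg (by omega), if_neg (by omega), if_neg (by omega)]
  have : x + n - k = x - k + n := by ring
  rw [this, Int.add_emod_right]

theorem foldZ_lt (m k n : ℕ) (hm : 0 < m) (hn : 0 < n) (x : ℤ) : foldZ m k n x < m + k + n := by
  rw [foldZ]
  have h1 := Int.emod_lt_of_pos x (show (0 : ℤ) < m by omega)
  have h2 := Int.emod_lt_of_pos (x - k) (show (0 : ℤ) < n by omega)
  split_ifs <;> omega

theorem foldZ_id (m k n : ℕ) (x : ℤ) (h1 : -(m : ℤ) ≤ x) (h2 : x < k + n) :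
    (foldZ m k n x : ℤ) = x + m := by
  rw [foldZ]
  split_ifs with h h'
  · have : x % m = x + m := by
      rw [← Int.add_emod_right, Int.emod_eq_of_lt (by omega) (by omega)]
    rw [this]
    omega
  · omega
  · rw [Int.emod_eq_of_lt (by omega) (by omega)]
    omega

theorem emod_succ_cases (x : ℤ) (n : ℕ) (hn : 0 < n) :
    (x + 1) % n = x % n + 1 ∨ ((x + 1) % n = 0 ∧ x % n = n - 1) := by
  have h1 := Int.emod_lt_of_pos x (show (0 : ℤ) < n by omega)
  have h0 := Int.emod_nonneg x (show (n : ℤ) ≠ 0 by omega)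
  have : (x + 1) % n = (x % n + 1) % n := by rw [Int.emod_add_emod]
  rw [this]
  by_cases h : x % n = n - 1
  · right
    refine ⟨?_, h⟩
    rw [h]; simp
  · left
    exact Int.emod_eq_of_lt (by omega) (by omega)

theorem foldZ_succ (m k n : ℕ) (hm : 0 < m) (hn : 0 < n) (x : ℤ) :
    foldZ m k n (x + 1) = foldZ m k n x + 1 ∨
    (foldZ m k n (x + 1) = 0 ∧ foldZ m k n x + 1 = m) ∨
    (foldZ m k n (x + 1) = m + k ∧ foldZ m k n x + 1 = m + k + n) := by
  by_cases hx : -1 ≤ x ∧ x + 1 < k + n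
  · left
    have h1 := foldZ_id m k n x (by omega) (by omega)
    have h2 := foldZ_id m k n (x + 1) (by omega) (by omega)
    omega
  · by_cases hx1 : x < -1
    · rw [foldZ, foldZ, if_pos (by omega), if_pos (by omega)]
      have h0 := Int.emod_nonneg x (show (m : ℤ) ≠ 0 by omega)
      rcases emod_succ_cases x m hm with h | h <;> omega
    · rw [foldZ, foldZ, if_neg (by omega), if_neg (by omega)]
      have e : x + 1 - k = x - k + 1 := by ring
      have h0 := Int.emod_nonneg (x - k) (show (n : ℤ) ≠ 0 by omega)
      rw [if_neg (by omega), if_neg (by omega), e]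
      rcases emod_succ_cases (x - k) n hn with h | h <;> omega

/-- Windows of the folded sequence occur in the original sequence. -/
theorem fold_window {A : Type} (s : ℤ → A) (L m k n : ℕ) (hm : 0 < m) (hn : 0 < n) (i1 : ℤ)
    (h1 : ∀ l : ℕ, l ≤ L → s (i1 + l) = s (i1 + m + l))
    (h2 : ∀ l : ℕ, l ≤ L → s (i1 + m + k + l) = s (i1 + m + k + n + l)) (l : ℕ) :
    ∀ x : ℤ, l ≤ L → s (i1 + foldZ m k n (x + l)) = s (i1 + foldZ m k n x + l) := by
  have hstep : ∀ x : ℤ, ∀ l : ℕ, l ≤ L →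
      s (i1 + foldZ m k n (x + 1) + l) = s (i1 + foldZ m k n x + 1 + l) := by
    intro x l hl
    rcases foldZ_succ m k n hm hn x with h | ⟨h, h'⟩ | ⟨h, h'⟩
    · rw [h]; congr 1; push_cast; ring
    · rw [h]
      have : i1 + foldZ m k n x + 1 + l = i1 + m + l := by omega
      rw [this, ← h1 l hl]
      simp
    · rw [h]
      have : i1 + foldZ m k n x + 1 + l = i1 + m + k + n + l := by omega
      rw [this, ← h2 l hl]
      congr 1; push_cast; ring
  induction l with
  | zero => intro x _; simp
  | succ l ih =>
    intro x hl
    have := ih (x + 1) (by omega)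
    have e : x + ((l + 1 : ℕ) : ℤ) = x + 1 + l := by push_cast; ring
    rw [e, this, hstep x l (by omega)]
    congr 1; push_cast; ring


def GoodAt {T : Type} (τ : TilingSystem T) (c : ℤ × ℤ → T) (u : ℤ × ℤ) : Prop :=
  ∀ p ∈ τ.F, ∃ n ∈ p.support, c (n + u) ≠ p.data n

theorem valid_iff_goodAt {T : Type} (τ : TilingSystem T) (c : ℤ × ℤ → T) :
    τ.Valid c ↔ ∀ u, GoodAt τ c u :=
  ⟨fun h u p hp => h p hp u, fun h p hp u => h u p hp⟩

def Radius {T : Type} (τ : TilingSystem T) (W : ℕ) : Prop :=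
  ∀ p ∈ τ.F, ∀ n ∈ p.support, |n.1| ≤ W ∧ |n.2| ≤ W

theorem exists_radius {T : Type} (τ : TilingSystem T) : ∃ W, Radius τ W := by
  classical
  let A := τ.finite.toFinset.biUnion Pattern.support
  refine ⟨∑ n ∈ A, (n.1.natAbs + n.2.natAbs), ?_⟩
  intro p hp n hn
  have hA : n ∈ A := by
    simp only [A, Finset.mem_biUnion, Set.Finite.mem_toFinset]
    exact ⟨p, hp, hn⟩
  have := Finset.single_le_sum (f := fun n : ℤ × ℤ => n.1.natAbs + n.2.natAbs)
    (fun _ _ => Nat.zero_le _) hA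
  rw [Int.abs_eq_natAbs, Int.abs_eq_natAbs]
  constructor <;> omega

theorem goodAt_congr {T : Type} {τ : TilingSystem T} {W : ℕ} (hW : Radius τ W)
    {c c' : ℤ × ℤ → T} {u u' : ℤ × ℤ}
    (h : ∀ n : ℤ × ℤ, |n.1| ≤ W → |n.2| ≤ W → c (n + u) = c' (n + u')) (hg : GoodAt τ c u) :
    GoodAt τ c' u' := by
  intro p hp
  obtain ⟨n, hn, hne⟩ := hg p hp
  obtain ⟨h1, h2⟩ := hW p hp n hn
  exact ⟨n, hn, by rwa [← h n h1 h2]⟩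

def cfgOf {T : Type} (a : ℤ) (b m k n : ℕ) (L : List T) (d : T) (u : ℤ × ℤ) : T :=
  L.getD (foldZ m k n (u.1 - a * (u.2 / b)) * b + (u.2 % b).toNat) d

section
variable {T : Type} (a : ℤ) (b m k n : ℕ) (L : List T) (d : T)

theorem cfgOf_period (hb : 0 < b) : IsPeriod (cfgOf a b m k n L d) (a, (b : ℤ)) := by
  rintro ⟨x, y⟩
  have h1 : (y + b) / (b : ℤ) = y / b + 1 := Int.add_ediv_of_dvd_right (dvd_refl _) |>.trans (by
    rw [Int.ediv_self (by omega)])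
  have h2 : (y + b) % (b : ℤ) = y % b := Int.add_emod_right _ _
  simp only [cfgOf, Prod.mk_add_mk, h1, h2]
  congr 4
  ring

theorem cfgOf_left (x y : ℤ) (h : x - a * (y / b) < 0) :
    cfgOf a b m k n L d (x - m, y) = cfgOf a b m k n L d (x, y) := by
  have := foldZ_left m k n _ h
  simp only [cfgOf]
  rw [← this]
  congr 4
  ring

theorem cfgOf_right (x y : ℤ) (h : k ≤ x - a * (y / b)) :
    cfgOf a b m k n L d (x + n, y) = cfgOf a b m k n L d (x, y) := by
  have := foldZ_right m k n _ h
  simp only [cfgOf]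
  rw [← this]
  congr 4
  ring

end

theorem offset_bound (a y z : ℤ) (b W : ℕ) (hb : 0 < b) (hy : 0 ≤ y) (hy' : y < b) (hz : |z| ≤ W) :
    |a * ((z + y) / b)| ≤ a.natAbs * (W + 1) := by
  rw [abs_le] at hz
  have hb' : (0 : ℤ) < b := by omega
  have h1 : -(W : ℤ) ≤ (z + y) / b := by
    rw [Int.le_ediv_iff_mul_le hb']
    nlinarith
  have h2 : (z + y) / b < W + 1 := by
    rw [Int.ediv_lt_iff_lt_mul hb']
    nlinarith
  rw [abs_mul, Int.abs_eq_natAbs a]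
  apply mul_le_mul_of_nonneg_left _ (by positivity)
  rw [abs_le]
  constructor <;> omega

theorem isPeriod_add {T : Type} {c : ℤ × ℤ → T} {v w : ℤ × ℤ} (hv : IsPeriod c v)
    (hw : IsPeriod c w) : IsPeriod c (v + w) := by
  intro x
  rw [← add_assoc, hw, hv]

theorem isPeriod_zsmul {T : Type} {c : ℤ × ℤ → T} {v : ℤ × ℤ} (hv : IsPeriod c v) (z : ℤ) :
    IsPeriod c (z • v) := by
  obtain ⟨n, rfl | rfl⟩ := z.eq_nat_or_neg
  · rw [natCast_zsmul]; exact isPeriod_nsmul hv n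
  · rw [neg_smul, natCast_zsmul]; exact isPeriod_neg (isPeriod_nsmul hv n)

theorem goodAt_period {T : Type} (τ : TilingSystem T) {c : ℤ × ℤ → T} {v : ℤ × ℤ}
    (hv : IsPeriod c v) (u : ℤ × ℤ) : GoodAt τ c (u + v) ↔ GoodAt τ c u := by
  simp only [GoodAt, ← add_assoc, hv _]

/-- Reduction of the vertical coordinate. -/
theorem goodAt_reduce {T : Type} (τ : TilingSystem T) {c : ℤ × ℤ → T} {a : ℤ} {b : ℕ} (hb : 0 < b)
    (hv : IsPeriod c (a, (b : ℤ))) (h : ∀ x y : ℤ, 0 ≤ y → y < b → GoodAt τ c (x, y)) :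
    τ.Valid c := by
  rw [valid_iff_goodAt]
  rintro ⟨x, y⟩
  rw [← goodAt_period τ (isPeriod_zsmul hv (-(y / b)))]
  simp only [Prod.smul_mk, Prod.mk_add_mk, smul_eq_mul]
  apply h
  · have := Int.emod_nonneg y (show (b : ℤ) ≠ 0 by omega)
    rw [Int.emod_def] at this
    linarith
  · have := Int.emod_lt_of_pos y (show (0 : ℤ) < b by omega)
    rw [Int.emod_def] at this
    linarith

theorem cert_sound {T : Type} (τ : TilingSystem T) (W : ℕ) (hW : Radius τ W) (a : ℤ) (b m k n : ℕ)
    (L : List T) (d : T) (hb : 0 < b) (hm : 0 < m) (hn : 0 < n) (X : ℕ)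
    (hX : X = W + a.natAbs * (W + 1) + m + k + n)
    (hcheck : ∀ y < b, ∀ x < 2 * X + 1, GoodAt τ (cfgOf a b m k n L d) ((x : ℤ) - X, (y : ℤ)))
    (u : ℤ × ℤ) (hu : cfgOf a b m k n L d (u + ((m : ℤ), 0)) ≠ cfgOf a b m k n L d u) :
    τ.Valid (cfgOf a b m k n L d) ∧ HasSlope (cfgOf a b m k n L d) (dir (a, (b : ℤ))) := by
  have hper := cfgOf_period a b m k n L d hb
  constructor
  · apply goodAt_reduce τ hb hper
    intro x y hy hy'
    obtain ⟨X0, hX0⟩ : ∃ X0, X0 = W + a.natAbs * (W + 1) := ⟨_, rfl⟩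
    have hoff : ∀ z : ℤ, |z| ≤ W → |a * ((z + y) / b)| + W ≤ X0 := by
      intro z hz
      have := offset_bound a y z b W hb hy hy' hz
      rw [hX0]
      push_cast at this ⊢
      linarith
    have hbase : ∀ x : ℤ, -(X : ℤ) ≤ x → x ≤ X →
        GoodAt τ (cfgOf a b m k n L d) (x, y) := by
      intro x h1 h2
      have := hcheck y.toNat (by omega) (x + X).toNat (by omega)
      convert this using 2 <;> omega
    have hl : ∀ x : ℤ, x < -X0 → GoodAt τ (cfgOf a b m k n L d) (x, y) →
        GoodAt τ (cfgOf a b m k n L d) (x - m, y) := by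
      intro x hx hg
      refine goodAt_congr hW ?_ hg
      rintro ⟨p, q⟩ hp hq
      have h1 := hoff q hq
      simp only [Prod.mk_add_mk]
      simp only at hp
      rw [← cfgOf_left a b m k n L d (p + x) (q + y)]
      · congr 2; ring
      · have h2 := neg_abs_le (a * ((q + y) / b))
        have h3 := le_abs_self p
        linarith
    have hr : ∀ x : ℤ, k + X0 ≤ x → GoodAt τ (cfgOf a b m k n L d) (x, y) →
        GoodAt τ (cfgOf a b m k n L d) (x + n, y) := by
      intro x hx hg
      refine goodAt_congr hW ?_ hg
      rintro ⟨p, q⟩ hp hq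
      have h1 := hoff q hq
      simp only [Prod.mk_add_mk]
      simp only at hp
      rw [← cfgOf_right a b m k n L d (p + x) (q + y)]
      · congr 2; ring
      · have h2 := le_abs_self (a * ((q + y) / b))
        have h3 := neg_abs_le p
        linarith
    have hind : ∀ N : ℕ, ∀ x : ℤ, x.natAbs ≤ N → GoodAt τ (cfgOf a b m k n L d) (x, y) := by
      intro N
      induction N with
      | zero => intro x hx; exact hbase x (by omega) (by omega)
      | succ N ih =>
        intro x hx
        by_cases h1 : x < -(X : ℤ)
        · have := hl (x + m) (by omega) (ih _ (by omega))
          simpa using this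
        · by_cases h2 : (X : ℤ) < x
          · have := hr (x - n) (by omega) (ih _ (by omega))
            simpa using this
          · exact hbase x (by omega) (by omega)
    exact hind _ x le_rfl
  · refine ⟨⟨(a, (b : ℤ)), by simp; omega, hper, rfl⟩, ?_⟩
    rintro ⟨p, q⟩ hv hpq
    by_contra hdir
    rw [dir_eq_iff _ _ hv (by simp; omega)] at hdir
    simp only at hdir
    have hP := isPeriod_add (isPeriod_zsmul hpq (b : ℤ)) (isPeriod_zsmul hper (-q))
    have e : ((b : ℤ) • (p, q) + (-q) • (a, (b : ℤ)) : ℤ × ℤ) = (p * b - a * q, 0) := by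
      simp only [Prod.smul_mk, Prod.mk_add_mk, smul_eq_mul]
      ext <;> simp <;> ring
    rw [e] at hP
    obtain ⟨P, hPdef⟩ : ∃ P, P = p * b - a * q := ⟨_, rfl⟩
    have hP0 : P ≠ 0 := by rw [hPdef]; exact sub_ne_zero.2 hdir
    rw [← hPdef] at hP
    obtain ⟨x, y⟩ := u
    apply hu
    -- shift far to the left
    obtain ⟨z, hz⟩ : ∃ z : ℤ, x + z * P + m - a * (y / b) < 0 := by
      obtain ⟨M, hM⟩ : ∃ M : ℤ, M = x + m - a * (y / b) := ⟨_, rfl⟩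
      refine ⟨-(|M| + 1) * P, ?_⟩
      have h1 : 1 ≤ P * P := by
        rcases lt_or_gt_of_ne hP0 with h | h <;> nlinarith
      have h2 := le_abs_self M
      have h3 := abs_nonneg M
      nlinarith
    have hs := isPeriod_zsmul hP z
    rw [← hs, ← hs (x, y)]
    simp only [Prod.smul_mk, Prod.mk_add_mk, smul_eq_mul, mul_zero, add_zero]
    rw [← cfgOf_left]
    · congr 2; ring
    · linarith

theorem cert_complete {T : Type} [Finite T] (τ : TilingSystem T) (W : ℕ) (hW : Radius τ W) (a : ℤ)
    (b : ℕ) (hb : 0 < b) (d : T) (c : ℤ × ℤ → T) (hc : τ.Valid c) (hper : IsPeriod c (a, (b : ℤ)))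
    (hnp : ∀ P : ℤ, 0 < P → ¬ IsPeriod c (P, 0)) :
    ∃ (m k n : ℕ) (L : List T) (u : ℤ × ℤ), 0 < m ∧ 0 < n ∧ τ.Valid (cfgOf a b m k n L d) ∧
      cfgOf a b m k n L d (u + ((m : ℤ), 0)) ≠ cfgOf a b m k n L d u := by
  let s : ℤ → (Fin b → T) := fun x i => c (x, ((i : ℕ) : ℤ))
  have hcs : ∀ x y, c (x, y) = c (x - a * (y / b), y % b) := by
    intro x y
    rw [← isPeriod_zsmul hper (-(y / b)) (x, y)]
    simp only [Prod.smul_mk, Prod.mk_add_mk, smul_eq_mul, Int.emod_def]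
    congr 2 <;> ring
  have hy0 : ∀ y : ℤ, 0 ≤ y % b := fun y => Int.emod_nonneg y (by omega)
  have hyb : ∀ y : ℤ, y % b < b := fun y => Int.emod_lt_of_pos y (by omega)
  have hss : ∀ x x', s x = s x' → ∀ y : ℤ, c (x, y % b) = c (x', y % b) := by
    intro x x' h y
    have := congrFun h ⟨(y % b).toNat, by have := hy0 y; have := hyb y; omega⟩
    simp only [s] at this
    rwa [Int.toNat_of_nonneg (hy0 y)] at this
  have hs : ∀ P : ℤ, 0 < P → ∃ x, s (x + P) ≠ s x := by
    intro P hP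
    by_contra! h
    apply hnp P hP
    rintro ⟨x, y⟩
    simp only [Prod.mk_add_mk, add_zero]
    rw [hcs, hcs x]
    have := hss _ _ (h (x - a * (y / b))) y
    rw [← this]
    congr 2; ring
  obtain ⟨X0, hX0⟩ : ∃ X0, X0 = W + a.natAbs * (W + 1) := ⟨_, rfl⟩
  obtain ⟨i1, i2, j1, j2, h12, hij, hj12, e1, e2, x, hx1, hx2, hne⟩ := exists_quad s hs (2 * X0)
  obtain ⟨m, hm⟩ : ∃ m : ℕ, (m : ℤ) = i2 - i1 := ⟨(i2 - i1).toNat, by omega⟩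
  obtain ⟨k, hk⟩ : ∃ k : ℕ, (k : ℤ) = j1 - i2 := ⟨(j1 - i2).toNat, by omega⟩
  obtain ⟨n, hn⟩ : ∃ n : ℕ, (n : ℤ) = j2 - j1 := ⟨(j2 - j1).toNat, by omega⟩
  have hm0 : 0 < m := by omega
  have hn0 : 0 < n := by omega
  let L : List T := (List.range ((m + k + n) * b)).map
    (fun q => c (i1 + ((q / b : ℕ) : ℤ), ((q % b : ℕ) : ℤ)))
  have hL : ∀ x y, cfgOf a b m k n L d (x, y) = c (i1 + foldZ m k n (x - a * (y / b)), y % b) := by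
    intro x y
    have hlt := foldZ_lt m k n hm0 hn0 (x - a * (y / b))
    simp only [cfgOf]
    obtain ⟨q, hq⟩ : ∃ q, q = foldZ m k n (x - a * (y / b)) := ⟨_, rfl⟩
    rw [← hq] at hlt ⊢
    have hyy : (y % b).toNat < b := by have := hy0 y; have := hyb y; omega
    have hidx : q * b + (y % b).toNat < (m + k + n) * b := by nlinarith
    have hd1 : (q * b + (y % b).toNat) / b = q := by
      rw [mul_comm, Nat.mul_add_div hb, Nat.div_eq_of_lt hyy, add_zero]
    have hd2 : (q * b + (y % b).toNat) % b = (y % b).toNat := by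
      rw [mul_comm, Nat.mul_add_mod, Nat.mod_eq_of_lt hyy]
    simp only [L, List.getD_eq_getElem?_getD, List.getElem?_map, List.getElem?_range hidx,
      Option.map_some, Option.getD_some, hd1, hd2, Int.toNat_of_nonneg (hy0 y)]
  refine ⟨m, k, n, L, ?_⟩
  have hwin := fun l => fold_window s (2 * X0) m k n hm0 hn0 i1
    (fun l hl => by rw [e1 l hl]; congr 1; omega)
    (fun l hl => by
      have := e2 l hl
      convert this using 2 <;> omega) l
  obtain ⟨i, hi⟩ := Function.ne_iff.1 hne
  have hib : (((i : ℕ) : ℤ) / (b : ℤ)) = 0 := Int.ediv_eq_zero_of_lt (by omega) (by have := i.2; omega)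
  have him : (((i : ℕ) : ℤ) % (b : ℤ)) = i := Int.emod_eq_of_lt (by omega) (by have := i.2; omega)
  refine ⟨(x - i2, ((i : ℕ) : ℤ)), hm0, hn0, ?_, ?_⟩
  · apply goodAt_reduce τ hb (cfgOf_period a b m k n L d hb)
    intro x y hy hy'
    have hg := (valid_iff_goodAt τ c).1 hc (i1 + foldZ m k n (x - X0) + X0, y)
    refine goodAt_congr hW ?_ hg
    rintro ⟨p, q⟩ hp hq
    simp only [Prod.mk_add_mk]
    rw [hL, hcs]
    have ho := offset_bound a y q b W hb hy hy' hq
    simp only at hp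
    obtain ⟨o, hodef⟩ : ∃ o, o = p - a * ((q + y) / b) := ⟨_, rfl⟩
    obtain ⟨l, hl⟩ : ∃ l : ℕ, (l : ℤ) = o + X0 ∧ l ≤ 2 * X0 := by
      have h1 := neg_abs_le (a * ((q + y) / b))
      have h2 := le_abs_self (a * ((q + y) / b))
      have h3 := neg_abs_le p
      have h4 := le_abs_self p
      have h5 : (X0 : ℤ) = W + a.natAbs * (W + 1) := by rw [hX0]; push_cast; ring
      refine ⟨(o + X0).toNat, ?_, ?_⟩ <;> omega
    have := hwin l (x - X0) hl.2
    have := hss _ _ this (q + y)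
    rw [show p + x - a * ((q + y) / b) = x - X0 + l by rw [hl.1, hodef]; ring, this]
    congr 2
    rw [hl.1, hodef]; ring
  · simp only [Prod.mk_add_mk, add_zero]
    rw [hL, hL, hib, him]
    simp only [mul_zero, sub_zero]
    rw [foldZ_id m k n _ (by omega) (by omega), foldZ_id m k n _ (by omega) (by omega)]
    convert hi using 1
    · simp only [s]; congr 2; omega
    · simp only [s]; congr 2; omega


section IntPrimrec
variable {α : Type} [Primcodable α]

theorem pz_sub {f g : α → ℕ} (hf : Primrec f) (hg : Primrec g) :
    Primrec fun a => (f a : ℤ) - (g a : ℤ) := primrec_subNatNat.comp hf hg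

theorem pz_cast {f : α → ℕ} (hf : Primrec f) : Primrec fun a => (f a : ℤ) :=
  (pz_sub hf (Primrec.const 0)).of_eq fun a => by simp

theorem pz_pos {f : α → ℤ} (hf : Primrec f) : Primrec fun a => (f a).toNat :=
  primrec_toNat.comp hf

theorem pz_negp {f : α → ℤ} (hf : Primrec f) : Primrec fun a => (-(f a)).toNat :=
  primrec_negToNat.comp hf

theorem pz_add {f g : α → ℤ} (hf : Primrec f) (hg : Primrec g) :
    Primrec fun a => f a + g a :=
  (pz_sub (Primrec.nat_add.comp (pz_pos hf) (pz_pos hg))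
    (Primrec.nat_add.comp (pz_negp hf) (pz_negp hg))).of_eq fun a => by omega

theorem pz_neg {f : α → ℤ} (hf : Primrec f) : Primrec fun a => -(f a) :=
  (pz_sub (pz_negp hf) (pz_pos hf)).of_eq fun a => by omega

theorem pz_minus {f g : α → ℤ} (hf : Primrec f) (hg : Primrec g) :
    Primrec fun a => f a - g a :=
  (pz_add hf (pz_neg hg)).of_eq fun a => by ring

theorem pz_natAbs {f : α → ℤ} (hf : Primrec f) : Primrec fun a => (f a).natAbs :=
  (Primrec.nat_add.comp (pz_pos hf) (pz_negp hf)).of_eq fun a => by omega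

theorem pz_mul {f g : α → ℤ} (hf : Primrec f) (hg : Primrec g) :
    Primrec fun a => f a * g a :=
  (pz_sub
    (Primrec.nat_add.comp (Primrec.nat_mul.comp (pz_pos hf) (pz_pos hg))
      (Primrec.nat_mul.comp (pz_negp hf) (pz_negp hg)))
    (Primrec.nat_add.comp (Primrec.nat_mul.comp (pz_pos hf) (pz_negp hg))
      (Primrec.nat_mul.comp (pz_negp hf) (pz_pos hg)))).of_eq fun a => by
    have h1 : f a = ((f a).toNat : ℤ) - ((-(f a)).toNat : ℤ) := by omega
    have h2 : g a = ((g a).toNat : ℤ) - ((-(g a)).toNat : ℤ) := by omega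
    conv_rhs => rw [h1, h2]
    push_cast
    ring

theorem pz_lt {f g : α → ℤ} (hf : Primrec f) (hg : Primrec g) :
    PrimrecPred fun a => f a < g a :=
  (Primrec.nat_lt.comp (Primrec.nat_add.comp (pz_pos hf) (pz_negp hg))
    (Primrec.nat_add.comp (pz_pos hg) (pz_negp hf))).of_eq fun a => by omega

theorem neg_div_aux (z : ℤ) (b : ℕ) (hz : z < 0) (hb : 0 < b) :
    z / (b : ℤ) = -((((-z).toNat - 1) / b : ℕ) : ℤ) - 1 ∧
      (z % (b : ℤ)).toNat = b - 1 - ((-z).toNat - 1) % b := by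
  obtain ⟨k, rfl⟩ : ∃ k : ℕ, z = -(k : ℤ) - 1 := ⟨(-z).toNat - 1, by omega⟩
  have e : (-(-(k : ℤ) - 1)).toNat - 1 = k := by omega
  rw [e]
  have h1 := Nat.div_add_mod k b
  have h2 := Nat.mod_lt k hb
  have key : -(k : ℤ) - 1 = (b - 1 - (k % b : ℕ) : ℤ) + b * (-((k / b : ℕ) : ℤ) - 1) := by
    have : (k : ℤ) = b * ((k / b : ℕ) : ℤ) + ((k % b : ℕ) : ℤ) := by exact_mod_cast h1.symm
    linear_combination -this
  have hb' : (b : ℤ) ≠ 0 := by omega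
  constructor
  · rw [key, Int.add_mul_ediv_left _ _ hb', Int.ediv_eq_zero_of_lt] <;> omega
  · rw [key, Int.add_mul_emod_self_left, Int.emod_eq_of_lt] <;> omega

theorem pz_div {f : α → ℤ} {g : α → ℕ} (hf : Primrec f) (hg : Primrec g) :
    Primrec fun a => f a / (g a : ℤ) := by
  refine (Primrec.ite (c := fun a => g a = 0) (Primrec.eq.comp hg (Primrec.const 0))
    (Primrec.const 0)
    (Primrec.ite (c := fun a => f a < 0) (pz_lt hf (Primrec.const 0))
      (pz_minus (pz_neg (pz_cast (Primrec.nat_div.comp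
        (Primrec.nat_sub.comp (pz_negp hf) (Primrec.const 1)) hg))) (Primrec.const 1))
      (pz_cast (Primrec.nat_div.comp (pz_pos hf) hg)))).of_eq fun a => ?_
  split_ifs with h1 h2
  · simp [h1]
  · exact (neg_div_aux _ _ h2 (by omega)).1.symm
  · rw [Int.natCast_div]; congr 1; omega

theorem pz_mod {f : α → ℤ} {g : α → ℕ} (hf : Primrec f) (hg : Primrec g) :
    Primrec fun a => (f a % (g a : ℤ)).toNat := by
  refine (pz_pos (pz_minus hf (pz_mul (pz_cast hg) (pz_div hf hg)))).of_eq fun a => ?_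
  rw [Int.emod_def]

theorem pz_foldZ {m k n : α → ℕ} {x : α → ℤ} (hm : Primrec m) (hk : Primrec k) (hn : Primrec n)
    (hx : Primrec x) : Primrec fun a => foldZ (m a) (k a) (n a) (x a) :=
  Primrec.ite (pz_lt hx (Primrec.const 0)) (pz_mod hx hm)
    (Primrec.ite (pz_lt hx (pz_cast hk)) (Primrec.nat_add.comp hm (pz_pos hx))
      (Primrec.nat_add.comp (Primrec.nat_add.comp hm hk) (pz_mod (pz_minus hx (pz_cast hk)) hn)))

theorem pz_cfgOf {T : Type} [Primcodable T] (d : T) {A : α → ℤ} {b m k n : α → ℕ} {L : α → List T}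
    {u : α → ℤ × ℤ} (hA : Primrec A) (hb : Primrec b) (hm : Primrec m) (hk : Primrec k)
    (hn : Primrec n) (hL : Primrec L) (hu : Primrec u) :
    Primrec fun a => cfgOf (A a) (b a) (m a) (k a) (n a) (L a) d (u a) := by
  have h1 := Primrec.fst.comp hu
  have h2 := Primrec.snd.comp hu
  exact (Primrec.list_getD d).comp hL (Primrec.nat_add.comp (Primrec.nat_mul.comp
    (pz_foldZ hm hk hn (pz_minus h1 (pz_mul hA (pz_div h2 hb)))) hb) (pz_mod h2 hb))

theorem pp_const (p : Prop) : PrimrecPred fun _ : α => p := by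
  classical
  exact ⟨fun _ => Classical.propDecidable p, Primrec.const _⟩

theorem pp_forall_fin {ι : Type} {s : Set ι} (hs : s.Finite) {P : ι → α → Prop}
    (h : ∀ i ∈ s, PrimrecPred (P i)) : PrimrecPred fun a => ∀ i ∈ s, P i a := by
  induction s, hs using Set.Finite.induction_on with
  | empty => exact (pp_const True).of_eq fun a => by simp
  | @insert i s hi hs ih =>
    exact ((h i (Set.mem_insert _ _)).and
      (ih fun j hj => h j (Set.mem_insert_of_mem _ hj))).of_eq fun a => by simp

theorem pp_exists_fin {ι : Type} (s : Finset ι) {P : ι → α → Prop}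
    (h : ∀ i, PrimrecPred (P i)) : PrimrecPred fun a => ∃ i ∈ s, P i a := by
  refine (pp_forall_fin (s := (s : Set ι)) s.finite_toSet
    (P := fun i a => ¬ P i a) (fun i _ => (h i).not)).not.of_eq fun a => ?_
  push Not
  simp

theorem pp_goodAt {T : Type} [Primcodable T] (τ : TilingSystem T) {c : α → ℤ × ℤ → T}
    (hc : Primrec₂ c) {u : α → ℤ × ℤ} (hu : Primrec u) :
    PrimrecPred fun a => GoodAt τ (c a) (u a) := by
  refine pp_forall_fin τ.finite fun p _ => pp_exists_fin _ fun n => ?_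
  refine (Primrec.eq.comp (hc.comp Primrec.id ?_) (Primrec.const _)).not
  exact ((pz_add (Primrec.const n.1) (Primrec.fst.comp hu)).pair
    (pz_add (Primrec.const n.2) (Primrec.snd.comp hu))).of_eq fun a => rfl

end IntPrimrec


theorem pr_forall_lt {β : Type} [Primcodable β] {R : ℕ → β → Prop} (hf : PrimrecRel R) :
    PrimrecRel fun n y => ∀ x < n, R x y :=
  (hf.forall_mem_list.comp (Primrec.list_range.comp Primrec.fst) Primrec.snd).of_eq (by simp)

/-- The verification of a certificate for an eventually periodic tiling. -/
def CertOK {T : Type} (τ : TilingSystem T) (W : ℕ) (d : T) (A : ℤ) (b m k n : ℕ) (L : List T)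
    (u : ℤ × ℤ) : Prop :=
  (∀ y < b, ∀ x < 2 * (W + A.natAbs * (W + 1) + m + k + n) + 1,
    GoodAt τ (cfgOf A b m k n L d)
      ((x : ℤ) - ((W + A.natAbs * (W + 1) + m + k + n : ℕ) : ℤ), (y : ℤ))) ∧
  cfgOf A b m k n L d (u.1 + (m : ℤ), u.2) ≠ cfgOf A b m k n L d u

theorem pp_certOK {α T : Type} [Primcodable α] [Primcodable T] (τ : TilingSystem T) (W : ℕ) (d : T)
    {A : α → ℤ} {b m k n : α → ℕ} {L : α → List T} {u : α → ℤ × ℤ}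
    (hA : Primrec A) (hb : Primrec b) (hm : Primrec m) (hk : Primrec k)
    (hn : Primrec n) (hL : Primrec L) (hu : Primrec u) :
    PrimrecPred fun a => CertOK τ W d (A a) (b a) (m a) (k a) (n a) (L a) (u a) := by
  have hX : Primrec fun a => W + (A a).natAbs * (W + 1) + m a + k a + n a :=
    Primrec.nat_add.comp (Primrec.nat_add.comp (Primrec.nat_add.comp
      (Primrec.nat_add.comp (Primrec.const W)
        (Primrec.nat_mul.comp (pz_natAbs hA) (Primrec.const (W + 1)))) hm) hk) hn
  refine PrimrecPred.and ?_ ?_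
  · have base : PrimrecRel fun (x : ℕ) (q : ℕ × α) =>
        GoodAt τ (cfgOf (A q.2) (b q.2) (m q.2) (k q.2) (n q.2) (L q.2) d)
          ((x : ℤ) - ((W + (A q.2).natAbs * (W + 1) + m q.2 + k q.2 + n q.2 : ℕ) : ℤ),
            (q.1 : ℤ)) := by
      have s2 : Primrec fun r : ℕ × ℕ × α => r.2.2 := Primrec.snd.comp Primrec.snd
      have s3 : Primrec fun r : (ℕ × ℕ × α) × (ℤ × ℤ) => r.1.2.2 := s2.comp Primrec.fst
      exact pp_goodAt τ (c := fun (r : ℕ × ℕ × α) =>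
          cfgOf (A r.2.2) (b r.2.2) (m r.2.2) (k r.2.2) (n r.2.2) (L r.2.2) d)
        (pz_cfgOf d (hA.comp s3) (hb.comp s3) (hm.comp s3) (hk.comp s3) (hn.comp s3)
          (hL.comp s3) Primrec.snd)
        ((pz_minus (pz_cast Primrec.fst) (pz_cast (hX.comp s2))).pair
          (pz_cast (Primrec.fst.comp Primrec.snd)))
    have inner : PrimrecRel fun (y : ℕ) (a : α) =>
        ∀ x < 2 * (W + (A a).natAbs * (W + 1) + m a + k a + n a) + 1,
        GoodAt τ (cfgOf (A a) (b a) (m a) (k a) (n a) (L a) d)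
          ((x : ℤ) - ((W + (A a).natAbs * (W + 1) + m a + k a + n a : ℕ) : ℤ), (y : ℤ)) := by
      have hy := pr_forall_lt base
      exact hy.comp (α := ℕ × α)
        (Primrec.succ.comp (Primrec.nat_mul.comp (Primrec.const 2) (hX.comp Primrec.snd)))
        Primrec.id
    have hz := pr_forall_lt inner
    exact hz.comp hb Primrec.id
  · refine (Primrec.eq.comp (pz_cfgOf d hA hb hm hk hn hL ?_) (pz_cfgOf d hA hb hm hk hn hL hu)).not
    exact (pz_add (Primrec.fst.comp hu) (pz_cast hm)).pair (Primrec.snd.comp hu)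

abbrev Cert (T : Type) := ℕ × ℕ × ℕ × ℕ × List T × (ℤ × ℤ)

/-- The semi-decision predicate: `x` certifies that `dir v` is a slope. -/
def Chk {T : Type} (τ : TilingSystem T) (W : ℕ) (d : T) (v : ℤ × ℤ) (x : Cert T) : Prop :=
  (v.2 = 0 ∧ some 0 ∈ τ.Slopes) ∨
  (v.2 ≠ 0 ∧ CertOK τ W d (((x.1 + 1 : ℕ) : ℤ) * (if v.2 < 0 then -v.1 else v.1))
    ((x.1 + 1) * v.2.natAbs) (x.2.1 + 1) x.2.2.1 (x.2.2.2.1 + 1) x.2.2.2.2.1 x.2.2.2.2.2)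

theorem pp_Chk {T : Type} [Primcodable T] (τ : TilingSystem T) (W : ℕ) (d : T) :
    PrimrecRel (Chk τ W d) := by
  have hv : Primrec fun r : (ℤ × ℤ) × Cert T => r.1 := Primrec.fst
  have h1 : Primrec fun r : (ℤ × ℤ) × Cert T => r.2 := Primrec.snd
  have h2 := Primrec.snd.comp h1
  have h3 := Primrec.snd.comp h2
  have h4 := Primrec.snd.comp h3
  have h5 := Primrec.snd.comp h4
  have hv1 := Primrec.fst.comp hv
  have hv2 := Primrec.snd.comp hv
  have hz : PrimrecPred fun r : (ℤ × ℤ) × Cert T => r.1.2 = 0 :=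
    Primrec.eq.comp hv2 (Primrec.const 0)
  have hK : Primrec fun r : (ℤ × ℤ) × Cert T => r.2.1 + 1 := Primrec.succ.comp (Primrec.fst.comp h1)
  refine (hz.and (pp_const _)).or (hz.not.and ?_)
  exact pp_certOK τ W d
    (pz_mul (pz_cast hK) (Primrec.ite (pz_lt hv2 (Primrec.const 0)) (pz_neg hv1) hv1))
    (Primrec.nat_mul.comp hK (pz_natAbs hv2))
    (Primrec.succ.comp (Primrec.fst.comp h2)) (Primrec.fst.comp h3)
    (Primrec.succ.comp (Primrec.fst.comp h4)) (Primrec.fst.comp h5) (Primrec.snd.comp h5)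

theorem exists_Chk_iff {T : Type} [Finite T] (τ : TilingSystem T) (W : ℕ) (hW : Radius τ W) (d : T)
    (v : ℤ × ℤ) (hv : v ≠ 0) : (∃ x, Chk τ W d v x) ↔ dir v ∈ τ.Slopes := by
  by_cases h0 : v.2 = 0
  · have hv1 : v.1 ≠ 0 := fun h => hv (Prod.ext h h0)
    have : dir v = some 0 := by simp [dir, h0, hv1]
    rw [this]
    constructor
    · rintro ⟨x, ⟨-, h⟩ | ⟨h, -⟩⟩
      · exact h
      · exact absurd h0 h
    · exact fun h => ⟨(0, 0, 0, 0, [], 0), Or.inl ⟨h0, h⟩⟩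
  set a0 : ℤ := if v.2 < 0 then -v.1 else v.1 with ha0
  have hb0 : 0 < v.2.natAbs := by omega
  constructor
  · rintro ⟨x, ⟨h, -⟩ | ⟨-, h⟩⟩
    · exact absurd h h0
    have hb : 0 < (x.1 + 1) * v.2.natAbs := by positivity
    have := cert_sound τ W hW _ _ _ _ _ _ d hb (Nat.succ_pos _) (Nat.succ_pos _) _ rfl h.1
      x.2.2.2.2.2 (by
        have := h.2
        have e : x.2.2.2.2.2 + (((x.2.1 + 1 : ℕ) : ℤ), 0) =
          (x.2.2.2.2.2.1 + ((x.2.1 + 1 : ℕ) : ℤ), x.2.2.2.2.2.2) := by ext <;> simp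
        rw [e]
        exact this)
    refine ⟨_, this.1, ?_⟩
    convert this.2 using 1
    rw [dir_eq_iff v _ hv]
    · push_cast
      rcases lt_or_ge v.2 0 with h | h
      · simp only [h, if_true]
        rw [abs_of_neg h]; ring
      · simp only [not_lt.2 h, if_false]
        rw [abs_of_nonneg h]; ring
    · intro h
      have := congrArg Prod.snd h
      simp only [Prod.snd_zero] at this
      omega
  · rintro ⟨c, hc, ⟨w, hw, hwp, hwd⟩, hall⟩
    rw [dir_eq_iff w v hw hv] at hwd
    have hw2 : w.2 ≠ 0 := by
      intro h
      rw [h, mul_zero] at hwd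
      rcases mul_eq_zero.1 hwd with h' | h'
      · exact hw (Prod.ext h' h)
      · exact h0 h'
    obtain ⟨K, hK⟩ : ∃ K : ℕ, w.2.natAbs = K + 1 := ⟨w.2.natAbs - 1, by omega⟩
    have hper : IsPeriod c (((K + 1 : ℕ) : ℤ) * a0, (((K + 1) * v.2.natAbs : ℕ) : ℤ)) := by
      rw [← hK]
      have e : ∃ z : ℤ, z • w = (((w.2.natAbs : ℕ) : ℤ) * a0, ((w.2.natAbs * v.2.natAbs : ℕ) : ℤ)) := by
        refine ⟨w.2.sign * (v.2.natAbs : ℤ), ?_⟩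
        rcases lt_or_gt_of_ne h0 with h | h <;> rcases lt_or_gt_of_ne hw2 with h' | h' <;>
        · first | rw [Int.sign_eq_neg_one_of_neg h'] | rw [Int.sign_eq_one_of_pos h']
          simp only [ha0, h, not_lt.2 h.le, if_true, if_false]
          push_cast
          first | rw [abs_of_neg h] | rw [abs_of_pos h]
          first | rw [abs_of_neg h'] | rw [abs_of_pos h']
          ext
          · simp only [Prod.smul_fst, smul_eq_mul]
            first | linear_combination hwd | linear_combination -hwd
          · simp only [Prod.smul_snd, smul_eq_mul]
            ring
      obtain ⟨z, hz⟩ := e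
      rw [← hz]
      exact isPeriod_zsmul hwp z
    obtain ⟨m, k, n, L, u, hm, hn, hval, hu⟩ := cert_complete τ W hW _ _
      (by positivity : 0 < (K + 1) * v.2.natAbs) d c hc hper (by
        intro P hP hPp
        have hne : ((P, 0) : ℤ × ℤ) ≠ 0 := by
          intro h; have := congrArg Prod.fst h; simp at this; omega
        have := hall (P, 0) hne hPp
        rw [dir_eq_iff _ _ hne hv] at this
        simp only [mul_zero] at this
        rcases mul_eq_zero.1 this with h | h
        · omega
        · exact h0 h)
    obtain ⟨m, rfl⟩ : ∃ m', m = m' + 1 := ⟨m - 1, by omega⟩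
    obtain ⟨n, rfl⟩ : ∃ n', n = n' + 1 := ⟨n - 1, by omega⟩
    rw [valid_iff_goodAt] at hval
    refine ⟨(K, m, k, n, L, u), Or.inr ⟨h0, fun y _ x _ => hval _, ?_⟩⟩
    have e : u + (((m + 1 : ℕ) : ℤ), 0) = (u.1 + ((m + 1 : ℕ) : ℤ), u.2) := by ext <;> simp
    rw [e] at hu
    exact hu

theorem re_of_slopes {N : ℕ} (τ : TilingSystem (Fin N)) :
    ∃ f : ℤ × ℤ →. Unit, Partrec f ∧
      ∀ p : ℤ × ℤ, p ≠ 0 → ((f p).Dom ↔ dir p ∈ τ.Slopes) := by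
  classical
  rcases Nat.eq_zero_or_pos N with rfl | hN
  · refine ⟨fun _ => Part.none, Partrec.none, fun p _ => ?_⟩
    constructor
    · intro h; exact absurd h (by simp)
    · rintro ⟨c, -⟩; exact (c 0).elim0
  obtain ⟨W, hW⟩ := exists_radius τ
  let d : Fin N := ⟨0, hN⟩
  refine ⟨fun v => Nat.rfindOpt fun i =>
    (Encodable.decode (α := Cert (Fin N)) i).bind fun x => if Chk τ W d v x then some () else none,
    ?_, ?_⟩
  · refine Partrec.rfindOpt (Primrec.to_comp ?_)
    refine Primrec.option_bind (Primrec.decode.comp Primrec.snd) ?_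
    refine Primrec.ite ?_ (Primrec.const _) (Primrec.const _)
    exact (pp_Chk τ W d).comp (Primrec.fst.comp Primrec.fst) Primrec.snd
  · intro p hp
    rw [← exists_Chk_iff τ W hW d p hp, Nat.rfindOpt_dom]
    constructor
    · rintro ⟨i, a, h⟩
      rw [Option.mem_def, Option.bind_eq_some_iff] at h
      obtain ⟨x, -, hx⟩ := h
      refine ⟨x, ?_⟩
      by_contra hn
      simp [hn] at hx
    · rintro ⟨x, hx⟩
      exact ⟨Encodable.encode x, (), by simp [hx]⟩

/-- The sets of slopes of tiling systems are exactly the recursively enumerable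
subsets of `ℚ ∪ {∞}`. -/
theorem slopes_iff_re (S : Set (Option ℚ)) :
    (∃ f : ℤ × ℤ →. Unit, Partrec f ∧
        ∀ p : ℤ × ℤ, p ≠ 0 → ((f p).Dom ↔ dir p ∈ S)) ↔
      ∃ (N : ℕ) (τ : TilingSystem (Fin N)), τ.Slopes = S := by
  
  constructor
  · rintro ⟨f, hf, h⟩
    exact isSlopeSet_of_re S f hf h
  · rintro ⟨N, τ, rfl⟩
    exact re_of_slopes τ
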